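/- arXiv:2403.12353 — 6 statements merged into one kernel-verified Lean document; each statement's English description precedes it below -/
import Mathlib

section
/- Let 0 < α ≤ 1 and 1 < r ≤ 2 with conjugate exponent r′. There exists C > 0 (depending only on α and r) such that for all parameters N₁, N₂, N, L₁, L₂, L ≥ 1 and all nonnegative measurable functions f₁, f₂ ∈ L^{r′}(ℝ²) with supp f₁ ⊂ D_{N₁,L₁}, supp f₂ ⊂ D_{N₂,L₂}, and all nonnegative f ∈ L^r(ℝ²) with supp f ⊂ D_{N,L}, one has J(f₁,f₂,f) ≤ C · A · B · ‖f₁‖_{L^{r′}} ‖f₂‖_{L^{r′}} ‖f‖_{L^r}, where A = (min{L,L₁,L₂})^{1/r′} (min{L₁,L₂})^{1/r−1/r′} and B = (min{N,N₁,N₂})^{1/r′} (min{N₁,N₂})^{1/r−1/r′}. -/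
open MeasureTheory ENNReal

/-- Dispersion relation of the dispersion generalized Benjamin–Ono equation. -/
noncomputable def omegaBO (α ξ : ℝ) : ℝ := -ξ * |ξ| ^ (1 + α)

/-- Resonance function. -/
noncomputable def resBO (α ξ₁ ξ₂ : ℝ) : ℝ :=
  omegaBO α ξ₁ + omegaBO α ξ₂ - omegaBO α (ξ₁ + ξ₂)

/-- Dyadic frequency-modulation region. -/
def Dset (M K : ℝ) : Set (ℝ × ℝ) :=
  {z | M ≤ |z.1| ∧ |z.1| ≤ 2 * M ∧ K ≤ |z.2| ∧ |z.2| ≤ 2 * K}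

/-- The trilinear convolution functional J(f₁,f₂,f). -/
noncomputable def Jfun (α : ℝ) (f₁ f₂ f : ℝ × ℝ → ℝ) : ℝ≥0∞ :=
  ∫⁻ w : (ℝ × ℝ) × ℝ × ℝ,
    ENNReal.ofReal (f₁ (w.1.1, w.1.2) * f₂ (w.2.1, w.2.2) *
      f (w.1.1 + w.2.1, w.1.2 + w.2.2 + resBO α w.1.1 w.2.1))

/-- The L^p norm (with real exponent p) of a nonnegative function on ℝ². -/
noncomputable def LpN (p : ℝ) (f : ℝ × ℝ → ℝ) : ℝ≥0∞ :=
  (∫⁻ z : ℝ × ℝ, ENNReal.ofReal (f z) ^ p) ^ (1 / p)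


lemma aux_T (p q : ℝ) (hp : 0 < p) (hpq : p ≤ q) (G : ℝ → ℝ≥0∞) (hG : Measurable G)
    (S : Set ℝ) (hSm : MeasurableSet S) (hS : ∀ x, x ∉ S → G x = 0) (A : ℝ≥0∞) (hA : volume S ≤ A) :
    (∫⁻ x, G x ^ p) ^ (1 / p) ≤ A ^ (1 / p - 1 / q) * (∫⁻ x, G x ^ q) ^ (1 / q) := by
  have hq : 0 < q := hp.trans_le hpq
  have h := eLpNorm'_le_eLpNorm'_mul_rpow_measure_univ (μ := volume.restrict S) (f := G) hp hpq
    hG.aestronglyMeasurable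
  have key : ∀ t : ℝ, 0 < t → ∫⁻ x in S, G x ^ t = ∫⁻ x, G x ^ t := by
    intro t ht
    rw [← lintegral_indicator hSm]
    congr 1; ext x
    by_cases hx : x ∈ S
    · simp [hx]
    · simp [hx, hS x hx, ht]
  simp only [eLpNorm', enorm_eq_self, key p hp, key q hq, Measure.restrict_apply_univ] at h
  refine h.trans ?_
  rw [mul_comm]
  gcongr
  have := one_div_le_one_div_of_le hp hpq
  linarith

lemma aux_H1 (r r' : ℝ) (hr1 : 1 < r) (hr2 : r ≤ 2) (hrr : r.HolderConjugate r')
    (G₁ G₂ G : ℝ → ℝ≥0∞) (h1 : Measurable G₁) (h2 : Measurable G₂) (h : Measurable G)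
    (S : Set ℝ) (hSm : MeasurableSet S) (hS : ∀ x, x ∉ S → G₁ x = 0) (A : ℝ≥0∞) (hA : volume S ≤ A)
    (c : ℝ) :
    ∫⁻ s, ∫⁻ t, G₁ s * G₂ t * G (s + t + c) ≤
      A ^ (1 / r) * ((∫⁻ x, G₁ x ^ r') ^ (1 / r') * (∫⁻ x, G₂ x ^ r') ^ (1 / r') *
        (∫⁻ x, G x ^ r) ^ (1 / r)) := by
  have hr' : 1 < r' := hrr.symm.lt
  have e : 1 / r = 1 / 1 - 1 / r' := by
    have := hrr.inv_add_inv_eq_one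
    simp only [one_div]; linarith
  have step : ∀ s, ∫⁻ t, G₁ s * G₂ t * G (s + t + c) ≤
      G₁ s * ((∫⁻ x, G₂ x ^ r') ^ (1 / r') * (∫⁻ x, G x ^ r) ^ (1 / r)) := by
    intro s
    simp only [mul_assoc]
    rw [lintegral_const_mul _ (by fun_prop)]
    gcongr
    have := ENNReal.lintegral_mul_le_Lp_mul_Lq volume hrr.symm h2.aemeasurable
      (g := fun t => G (s + t + c)) (by fun_prop)
    refine this.trans ?_
    refine mul_le_mul_right (le_of_eq ?_) _
    congr 1
    rw [← lintegral_add_right_eq_self (fun x => G x ^ r) (s + c)]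
    congr 1; ext t; congr 2; ring
  refine (lintegral_mono step).trans ?_
  rw [lintegral_mul_const _ h1]
  have := aux_T 1 r' one_pos hr'.le G₁ h1 S hSm hS A hA
  simp only [rpow_one, div_one, one_div] at this ⊢
  simp only [one_div, inv_one] at e
  rw [e]
  calc _ ≤ _ := mul_le_mul_left this _
    _ = _ := by ring

lemma aux_H2 (r r' : ℝ) (hr1 : 1 < r) (hr2 : r ≤ 2) (hrr : r.HolderConjugate r')
    (G₁ G₂ G : ℝ → ℝ≥0∞) (h1 : Measurable G₁) (h2 : Measurable G₂) (h : Measurable G)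
    (S₁ : Set ℝ) (hSm₁ : MeasurableSet S₁) (hS₁ : ∀ x, x ∉ S₁ → G₁ x = 0)
    (A₁ : ℝ≥0∞) (hA₁ : volume S₁ ≤ A₁)
    (S : Set ℝ) (hSm : MeasurableSet S) (hS : ∀ x, x ∉ S → G x = 0) (A : ℝ≥0∞) (hA : volume S ≤ A)
    (c : ℝ) :
    ∫⁻ s, ∫⁻ t, G₁ s * G₂ t * G (s + t + c) ≤
      A ^ (1 / r') * A₁ ^ (1 / r - 1 / r') *
        ((∫⁻ x, G₁ x ^ r') ^ (1 / r') * (∫⁻ x, G₂ x ^ r') ^ (1 / r') *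
        (∫⁻ x, G x ^ r) ^ (1 / r)) := by
  have e : 1 / r' = 1 / 1 - 1 / r := by
    have := hrr.inv_add_inv_eq_one
    simp only [one_div]; linarith
  have hle : r ≤ r' := by
    have h0 := hrr.inv_add_inv_eq_one
    have h3 : (2:ℝ)⁻¹ ≤ r⁻¹ := inv_anti₀ (by linarith) hr2
    refine (inv_le_inv₀ hrr.symm.pos hrr.pos).1 ?_
    norm_num at h3; linarith
  have tr : ∀ s, ∫⁻ t, G₁ s * G₂ t * G (s + t + c) = ∫⁻ u, G₁ s * G₂ (u - s - c) * G u := by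
    intro s
    rw [← lintegral_add_right_eq_self (fun u => G₁ s * G₂ (u - s - c) * G u) (s + c)]
    congr 1; ext t; congr 2
    · congr 1; ring
    · ring
  simp only [tr]
  rw [lintegral_lintegral_swap (by fun_prop)]
  have step : ∀ u, ∫⁻ s, G₁ s * G₂ (u - s - c) * G u ≤
      ((∫⁻ x, G₁ x ^ r) ^ (1 / r) * (∫⁻ x, G₂ x ^ r') ^ (1 / r')) * G u := by
    intro u
    rw [lintegral_mul_const _ (by fun_prop)]
    gcongr
    have := ENNReal.lintegral_mul_le_Lp_mul_Lq volume hrr h1.aemeasurable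
      (g := fun s => G₂ (u - s - c)) (by fun_prop)
    refine this.trans ?_
    refine mul_le_mul_right (le_of_eq ?_) _
    congr 1
    rw [← lintegral_sub_left_eq_self (fun x => G₂ x ^ r') (u - c)]
    congr 1; ext t; congr 2; ring
  refine (lintegral_mono step).trans ?_
  rw [lintegral_const_mul _ h]
  have t1 := aux_T 1 r one_pos hr1.le G h S hSm hS A hA
  have t2 := aux_T r r' hrr.pos hle G₁ h1 S₁ hSm₁ hS₁ A₁ hA₁
  rw [← e] at t1
  simp only [rpow_one, div_one] at t1
  calc _ ≤ _ := mul_le_mul' (mul_le_mul_left t2 _) t1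
    _ = _ := by ring

lemma aux_min (r r' : ℝ) (hr1 : 1 < r) (hr2 : r ≤ 2) (hrr : r.HolderConjugate r')
    (G₁ G₂ G : ℝ → ℝ≥0∞) (h1 : Measurable G₁) (h2 : Measurable G₂) (h : Measurable G)
    (a₁ a₂ a : ℝ) (p1 : 0 < a₁) (p : 0 < a) (h12 : a₁ ≤ a₂)
    (hS₁ : ∀ x, ¬ |x| ≤ 2 * a₁ → G₁ x = 0)
    (hS : ∀ x, ¬ |x| ≤ 2 * a → G x = 0) (c : ℝ) :
    ∫⁻ s, ∫⁻ t, G₁ s * G₂ t * G (s + t + c) ≤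
      ENNReal.ofReal (4 ^ (1 / r) * (min a (min a₁ a₂) ^ (1 / r') * min a₁ a₂ ^ (1 / r - 1 / r'))) *
        ((∫⁻ x, G₁ x ^ r') ^ (1 / r') * (∫⁻ x, G₂ x ^ r') ^ (1 / r') *
        (∫⁻ x, G x ^ r) ^ (1 / r)) := by
  have meas : ∀ b : ℝ, MeasurableSet {x : ℝ | |x| ≤ 2 * b} := fun b =>
    measurableSet_le (by fun_prop) (by fun_prop)
  have vol : ∀ b : ℝ, volume {x : ℝ | |x| ≤ 2 * b} ≤ ENNReal.ofReal (4 * b) := by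
    intro b
    have : {x : ℝ | |x| ≤ 2 * b} = Set.Icc (-(2*b)) (2*b) := by
      ext x; simp [abs_le]
    rw [this, Real.volume_Icc]
    apply le_of_eq; congr 1; ring
  rw [min_eq_left h12]
  rcases le_total a₁ a with hc | hc
  · rw [min_eq_right hc]
    refine (aux_H1 r r' hr1 hr2 hrr G₁ G₂ G h1 h2 h _ (meas a₁) hS₁ _ (vol a₁) c).trans ?_
    gcongr
    rw [ENNReal.ofReal_rpow_of_pos (by positivity), ← Real.rpow_add p1,
      Real.mul_rpow (by norm_num) p1.le]
    apply le_of_eq; congr 3; ring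
  · rw [min_eq_left hc]
    refine (aux_H2 r r' hr1 hr2 hrr G₁ G₂ G h1 h2 h _ (meas a₁) hS₁ _ (vol a₁) _ (meas a) hS _
      (vol a) c).trans ?_
    gcongr
    rw [ENNReal.ofReal_rpow_of_pos (by positivity), ENNReal.ofReal_rpow_of_pos (by positivity),
      ← ENNReal.ofReal_mul (by positivity),
      Real.mul_rpow (by norm_num) p1.le, Real.mul_rpow (by norm_num) p.le]
    apply le_of_eq; congr 1
    have : (4:ℝ) ^ (1 / r) = 4 ^ (1 / r') * 4 ^ (1 / r - 1 / r') := by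
      rw [← Real.rpow_add (by norm_num)]; congr 1; ring
    rw [this]; ring

lemma aux_line (r r' : ℝ) (hr1 : 1 < r) (hr2 : r ≤ 2) (hrr : r.HolderConjugate r')
    (G₁ G₂ G : ℝ → ℝ≥0∞) (h1 : Measurable G₁) (h2 : Measurable G₂) (h : Measurable G)
    (a₁ a₂ a : ℝ) (p1 : 0 < a₁) (p2 : 0 < a₂) (p : 0 < a)
    (hS₁ : ∀ x, ¬ |x| ≤ 2 * a₁ → G₁ x = 0) (hS₂ : ∀ x, ¬ |x| ≤ 2 * a₂ → G₂ x = 0)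
    (hS : ∀ x, ¬ |x| ≤ 2 * a → G x = 0) (c : ℝ) :
    ∫⁻ s, ∫⁻ t, G₁ s * G₂ t * G (s + t + c) ≤
      ENNReal.ofReal (4 ^ (1 / r) * (min a (min a₁ a₂) ^ (1 / r') * min a₁ a₂ ^ (1 / r - 1 / r'))) *
        ((∫⁻ x, G₁ x ^ r') ^ (1 / r') * (∫⁻ x, G₂ x ^ r') ^ (1 / r') *
        (∫⁻ x, G x ^ r) ^ (1 / r)) := by
  rcases le_total a₁ a₂ with hc | hc
  · exact aux_min r r' hr1 hr2 hrr G₁ G₂ G h1 h2 h a₁ a₂ a p1 p hc hS₁ hS c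
  · have := aux_min r r' hr1 hr2 hrr G₂ G₁ G h2 h1 h a₂ a₁ a p2 p hc hS₂ hS c
    rw [lintegral_lintegral_swap (by fun_prop), min_comm a₁ a₂,
      mul_comm ((∫⁻ x, G₁ x ^ r') ^ (1 / r'))]
    refine le_trans (le_of_eq ?_) this
    congr 1; ext t; congr 1; ext s
    rw [mul_comm (G₁ s), add_comm s t]

/-- Basic dyadic bilinear estimate (Lemma 3.1). -/
theorem stmt6 (α r r' : ℝ) (hα0 : 0 < α) (hα1 : α ≤ 1)
    (hr1 : 1 < r) (hr2 : r ≤ 2) (hconj : 1 / r + 1 / r' = 1) :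
    ∃ C > (0 : ℝ), ∀ N₁ N₂ N L₁ L₂ L : ℝ,
      1 ≤ N₁ → 1 ≤ N₂ → 1 ≤ N → 1 ≤ L₁ → 1 ≤ L₂ → 1 ≤ L →
      ∀ f₁ f₂ f : ℝ × ℝ → ℝ,
        Measurable f₁ → (∀ z, 0 ≤ f₁ z) → Function.support f₁ ⊆ Dset N₁ L₁ →
        Measurable f₂ → (∀ z, 0 ≤ f₂ z) → Function.support f₂ ⊆ Dset N₂ L₂ →
        Measurable f → (∀ z, 0 ≤ f z) → Function.support f ⊆ Dset N L →
        Jfun α f₁ f₂ f ≤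
          ENNReal.ofReal (C *
              (min L (min L₁ L₂) ^ (1 / r') * min L₁ L₂ ^ (1 / r - 1 / r')) *
              (min N (min N₁ N₂) ^ (1 / r') * min N₁ N₂ ^ (1 / r - 1 / r'))) *
            (LpN r' f₁ * LpN r' f₂ * LpN r f) := by
  have hrr : r.HolderConjugate r' := by
    rw [Real.holderConjugate_iff]
    exact ⟨hr1, by simpa [one_div] using hconj⟩
  have hr0 : 0 < r := hrr.pos
  have hr0' : 0 < r' := hrr.symm.pos
  refine ⟨4 ^ (1 / r) * 4 ^ (1 / r), by positivity, ?_⟩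
  intro N₁ N₂ N L₁ L₂ L hN₁ hN₂ hN hL₁ hL₂ hL f₁ f₂ f m₁ n₁ s₁ m₂ n₂ s₂ m n s
  have z : ∀ (M K : ℝ) (g : ℝ × ℝ → ℝ), Function.support g ⊆ Dset M K → ∀ x y,
      (¬ |x| ≤ 2 * M ∨ ¬ |y| ≤ 2 * K) → ENNReal.ofReal (g (x, y)) = 0 := by
    intro M K g hg x y hxy
    have : g (x, y) = 0 := by
      by_contra hne
      have := hg hne
      simp only [Dset, Set.mem_ofPred_eq] at this
      tauto
    simp [this]
  have lp : ∀ (p : ℝ) (g : ℝ × ℝ → ℝ), 0 < p → Measurable g →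
      (∫⁻ x, ((∫⁻ y, ENNReal.ofReal (g (x, y)) ^ p) ^ (1 / p)) ^ p) ^ (1 / p) = LpN p g := by
    intro p g hp hg
    unfold LpN
    congr 1
    rw [Measure.volume_eq_prod, lintegral_prod _ (by fun_prop)]
    congr 1; ext x
    rw [← ENNReal.rpow_mul, one_div_mul_cancel hp.ne', ENNReal.rpow_one]
  have mF : ∀ (p : ℝ) (g : ℝ × ℝ → ℝ), Measurable g →
      Measurable (fun x => (∫⁻ y, ENNReal.ofReal (g (x, y)) ^ p) ^ (1 / p)) := by
    intro p g hg
    apply Measurable.pow_const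
    exact Measurable.lintegral_prod_right' (f := fun w : ℝ × ℝ => ENNReal.ofReal (g w) ^ p)
      (by fun_prop)
  have zF : ∀ (p : ℝ), 0 < p → ∀ (M K : ℝ) (g : ℝ × ℝ → ℝ), Function.support g ⊆ Dset M K → ∀ x,
      ¬ |x| ≤ 2 * M → (∫⁻ y, ENNReal.ofReal (g (x, y)) ^ p) ^ (1 / p) = 0 := by
    intro p hp M K g hg x hx
    simp only [z M K g hg x _ (Or.inl hx)]
    simp [hp]
  have mres : Measurable (fun w : ℝ × ℝ => resBO α w.1 w.2) := by
    unfold resBO omegaBO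
    fun_prop
  have hJ : Jfun α f₁ f₂ f = ∫⁻ ξ₁, ∫⁻ ξ₂, ∫⁻ σ₁, ∫⁻ σ₂, ENNReal.ofReal (f₁ (ξ₁, σ₁)) *
      ENNReal.ofReal (f₂ (ξ₂, σ₂)) *
      ENNReal.ofReal (f (ξ₁ + ξ₂, σ₁ + σ₂ + resBO α ξ₁ ξ₂)) := by
    have M4 : Measurable (fun w : (ℝ × ℝ) × ℝ × ℝ => ENNReal.ofReal (f₁ (w.1.1, w.1.2)) *
        ENNReal.ofReal (f₂ (w.2.1, w.2.2)) *
        ENNReal.ofReal (f (w.1.1 + w.2.1, w.1.2 + w.2.2 + resBO α w.1.1 w.2.1))) := by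
      have : Measurable (fun w : (ℝ × ℝ) × ℝ × ℝ => resBO α w.1.1 w.2.1) :=
        mres.comp (f := fun w : (ℝ × ℝ) × ℝ × ℝ => (w.1.1, w.2.1)) (by fun_prop)
      fun_prop
    unfold Jfun
    simp only [ENNReal.ofReal_mul (mul_nonneg (n₁ _) (n₂ _)), ENNReal.ofReal_mul (n₁ _)]
    rw [Measure.volume_eq_prod, lintegral_prod _ M4.aemeasurable, Measure.volume_eq_prod,
      lintegral_prod _ (Measurable.lintegral_prod_right' M4).aemeasurable]
    congr 1; ext ξ₁
    have e1 : ∀ σ₁ : ℝ, ∫⁻ y : ℝ × ℝ, ENNReal.ofReal (f₁ (ξ₁, σ₁)) *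
        ENNReal.ofReal (f₂ (y.1, y.2)) *
        ENNReal.ofReal (f (ξ₁ + y.1, σ₁ + y.2 + resBO α ξ₁ y.1)) ∂(volume.prod volume) =
        ∫⁻ ξ₂, ∫⁻ σ₂, ENNReal.ofReal (f₁ (ξ₁, σ₁)) *
        ENNReal.ofReal (f₂ (ξ₂, σ₂)) *
        ENNReal.ofReal (f (ξ₁ + ξ₂, σ₁ + σ₂ + resBO α ξ₁ ξ₂)) := by
      intro σ₁
      exact lintegral_prod _ (M4.comp (measurable_prodMk_left (x := (ξ₁, σ₁)))).aemeasurable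
    simp only [e1]
    rw [lintegral_lintegral_swap]
    refine Measurable.aemeasurable ?_
    exact Measurable.lintegral_prod_right' (f := fun w : (ℝ × ℝ) × ℝ =>
        ENNReal.ofReal (f₁ (ξ₁, w.1.1)) * ENNReal.ofReal (f₂ (w.1.2, w.2)) *
        ENNReal.ofReal (f (ξ₁ + w.1.2, w.1.1 + w.2 + resBO α ξ₁ w.1.2)))
      (M4.comp (g := _) (f := fun w : (ℝ × ℝ) × ℝ => (((ξ₁, w.1.1), (w.1.2, w.2)) :
        (ℝ × ℝ) × ℝ × ℝ)) (by fun_prop))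
  rw [hJ]
  set kL := min L (min L₁ L₂) ^ (1 / r') * min L₁ L₂ ^ (1 / r - 1 / r') with hkL
  set kN := min N (min N₁ N₂) ^ (1 / r') * min N₁ N₂ ^ (1 / r - 1 / r') with hkN
  have kL0 : 0 ≤ kL := by positivity
  have inner : ∀ ξ₁ ξ₂ : ℝ, ∫⁻ σ₁, ∫⁻ σ₂, ENNReal.ofReal (f₁ (ξ₁, σ₁)) *
      ENNReal.ofReal (f₂ (ξ₂, σ₂)) *
      ENNReal.ofReal (f (ξ₁ + ξ₂, σ₁ + σ₂ + resBO α ξ₁ ξ₂)) ≤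
      ENNReal.ofReal (4 ^ (1 / r) * kL) *
      ((∫⁻ y, ENNReal.ofReal (f₁ (ξ₁, y)) ^ r') ^ (1 / r') *
       (∫⁻ y, ENNReal.ofReal (f₂ (ξ₂, y)) ^ r') ^ (1 / r') *
       (∫⁻ y, ENNReal.ofReal (f (ξ₁ + ξ₂ + 0, y)) ^ r) ^ (1 / r)) := by
    intro ξ₁ ξ₂
    rw [add_zero]
    exact aux_line r r' hr1 hr2 hrr (fun y => ENNReal.ofReal (f₁ (ξ₁, y)))
      (fun y => ENNReal.ofReal (f₂ (ξ₂, y))) (fun y => ENNReal.ofReal (f (ξ₁ + ξ₂, y)))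
      (by fun_prop) (by fun_prop) (by fun_prop) L₁ L₂ L (by linarith) (by linarith) (by linarith)
      (fun x hx => z _ _ _ s₁ _ _ (Or.inr hx)) (fun x hx => z _ _ _ s₂ _ _ (Or.inr hx))
      (fun x hx => z _ _ _ s _ _ (Or.inr hx)) _
  refine (lintegral_mono fun ξ₁ => lintegral_mono fun ξ₂ => inner ξ₁ ξ₂).trans ?_
  have outer := aux_line r r' hr1 hr2 hrr _ _ _ (mF r' f₁ m₁) (mF r' f₂ m₂) (mF r f m)
    N₁ N₂ N (by linarith) (by linarith) (by linarith) (zF r' hr0' _ _ _ s₁) (zF r' hr0' _ _ _ s₂)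
    (zF r hr0 _ _ _ s) 0
  simp only [lp r' f₁ hr0' m₁, lp r' f₂ hr0' m₂, lp r f hr0 m] at outer
  simp only [lintegral_const_mul' _ _ ENNReal.ofReal_ne_top]
  refine (mul_le_mul_right outer _).trans (le_of_eq ?_)
  rw [← mul_assoc, ← ENNReal.ofReal_mul (by positivity)]
  congr 2
  rw [← hkN]
  ring
end

section
/- (High×low interactions, dominant modulation on the output.) Let 0 < α ≤ 1 and 1 < r ≤ 2 with conjugate exponent r′. There exists C > 0 (depending only on α and r) such that for all parameters N₁, N₂, N, L₁, L₂, L ≥ 1 with N₁ ≥ 4N₂ and L = max{L, L₁, L₂}, and all nonnegative measurable functions f₁, f₂ ∈ L^{r′}(ℝ²) with supp f₁ ⊂ D_{N₁,L₁}, supp f₂ ⊂ D_{N₂,L₂}, and nonnegative f ∈ L^r(ℝ²) with supp f ⊂ D_{N,L}, one has J(f₁,f₂,f) ≤ C L₁^{1/r} L₂^{1/r} N₁^{−(1+α)/r} ‖f₁‖_{L^{r′}} ‖f₂‖_{L^{r′}} ‖f‖_{L^r}. -/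
open MeasureTheory ENNReal

lemma omegaBO_hasDerivAt (α : ℝ) (hα0 : 0 < α) (x : ℝ) :
    HasDerivAt (omegaBO α) (-(2 + α) * |x| ^ (1 + α)) x := by
  have h1 : HasDerivAt (fun x : ℝ => |x| ^ (1 + α)) ((1 + α) * |x| ^ (1 + α - 2) * x) x :=
    hasDerivAt_abs_rpow x (by linarith)
  have h2 := ((hasDerivAt_id x).neg).mul h1
  have h3 : HasDerivAt (omegaBO α) _ x := h2
  convert h3 using 1
  have key : |x| ^ (1 + α - 2) * x * x = |x| ^ (1 + α) := by
    rcases eq_or_ne x 0 with rfl | hx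
    · simp only [abs_zero, mul_zero]
      rw [Real.zero_rpow (by linarith)]
    · have : 0 < |x| := abs_pos.mpr hx
      rw [mul_assoc, ← abs_mul_abs_self x, ← pow_two, ← Real.rpow_natCast, ← Real.rpow_add this]
      congr 1
      push_cast
      ring
  simp only [Pi.neg_apply, id]
  linear_combination (1 + α) * key

lemma subst_one (α N ξ c : ℝ) (hα0 : 0 < α) (hN : 1 ≤ N) (s : Set ℝ)
    (hs : MeasurableSet s) (hconv : Convex ℝ s) (h1 : ∀ x ∈ s, |x| ≤ N / 2)
    (h2 : ∀ x ∈ s, N ≤ |ξ - x|) (h : ℝ → ℝ≥0∞) :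
    ∫⁻ x in s, h (c + resBO α (ξ - x) x) ≤ ENNReal.ofReal (N ^ (-(1 + α))) * ∫⁻ t, h t := by
  set g : ℝ → ℝ := fun x => c + resBO α (ξ - x) x with hg
  set g' : ℝ → ℝ := fun x => (2 + α) * (|ξ - x| ^ (1 + α) - |x| ^ (1 + α)) with hg'
  have hder : ∀ x, HasDerivAt g (g' x) x := by
    intro x
    have e1 : HasDerivAt (fun x : ℝ => ξ - x) (-1) x := by
      simpa using (hasDerivAt_id x).const_sub ξ
    have e2 := (omegaBO_hasDerivAt α hα0 (ξ - x)).comp x e1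
    have e3 := ((e2.add (omegaBO_hasDerivAt α hα0 x)).sub_const (omegaBO α ξ)).const_add c
    have e4 : g = fun x => c + (((omegaBO α ∘ fun x => ξ - x) + omegaBO α) x - omegaBO α ξ) := by
      funext y
      simp [hg, resBO]
    rw [e4]
    refine HasDerivAt.congr_deriv e3 ?_
    simp only [hg']
    ring
  have hNp : 0 < N ^ (1 + α) := Real.rpow_pos_of_pos (by linarith) _
  have hlow : ∀ x ∈ s, N ^ (1 + α) ≤ g' x := by
    intro x hx
    have a1 : N ^ (1 + α) ≤ |ξ - x| ^ (1 + α) :=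
      Real.rpow_le_rpow (by linarith) (h2 x hx) (by linarith)
    have a2 : |x| ^ (1 + α) ≤ (N / 2) ^ (1 + α) :=
      Real.rpow_le_rpow (abs_nonneg _) (h1 x hx) (by linarith)
    have a3 : (N / 2) ^ (1 + α) ≤ N ^ (1 + α) / 2 := by
      rw [Real.div_rpow (by linarith) (by norm_num)]
      have : (2 : ℝ) ≤ 2 ^ (1 + α) := by
        calc (2 : ℝ) = 2 ^ (1 : ℝ) := by simp
          _ ≤ _ := Real.rpow_le_rpow_of_exponent_le (by norm_num) (by linarith)
      gcongr
    simp only [hg']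
    nlinarith
  have hinj : Set.InjOn g s := by
    apply StrictMonoOn.injOn
    apply strictMonoOn_of_deriv_pos hconv
    · exact fun x _ => (hder x).continuousAt.continuousWithinAt
    · intro x hx
      rw [(hder x).deriv]
      exact hNp.trans_le (hlow x (interior_subset hx))
  have hcv := lintegral_image_eq_lintegral_abs_deriv_mul hs
    (fun x _ => (hder x).hasDerivWithinAt) hinj h
  have hone : ENNReal.ofReal (N ^ (-(1 + α))) * ENNReal.ofReal (N ^ (1 + α)) = 1 := by
    rw [← ENNReal.ofReal_mul (by positivity), ← Real.rpow_add (by linarith)]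
    simp
  calc ∫⁻ x in s, h (g x)
      = ENNReal.ofReal (N ^ (-(1 + α))) *
          (ENNReal.ofReal (N ^ (1 + α)) * ∫⁻ x in s, h (g x)) := by
        rw [← mul_assoc, hone, one_mul]
    _ = ENNReal.ofReal (N ^ (-(1 + α))) *
          (∫⁻ x in s, ENNReal.ofReal (N ^ (1 + α)) * h (g x)) := by
        rw [lintegral_const_mul' _ _ ENNReal.ofReal_ne_top]
    _ ≤ ENNReal.ofReal (N ^ (-(1 + α))) *
          (∫⁻ x in s, ENNReal.ofReal |g' x| * h (g x)) := by
        refine mul_le_mul_right (setLIntegral_mono' hs fun x hx => ?_) _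
        gcongr
        exact (hlow x hx).trans (le_abs_self _)
    _ = ENNReal.ofReal (N ^ (-(1 + α))) * ∫⁻ t in g '' s, h t := by rw [hcv]
    _ ≤ _ := by
        gcongr
        exact Measure.restrict_le_self

/-- cutoff functions -/
noncomputable def cutLow (R : ℝ) : ℝ → ℝ≥0∞ := {x : ℝ | |x| ≤ R}.indicator 1

noncomputable def cutHigh (R : ℝ) : ℝ → ℝ≥0∞ := {x : ℝ | R ≤ |x|}.indicator 1

@[fun_prop]
lemma cutLow_meas (R : ℝ) : Measurable (cutLow R) :=
  measurable_one.indicator (measurableSet_le (by fun_prop) (by fun_prop))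

@[fun_prop]
lemma cutHigh_meas (R : ℝ) : Measurable (cutHigh R) :=
  measurable_one.indicator (measurableSet_le (by fun_prop) (by fun_prop))

lemma cutLow_int (R : ℝ) : ∫⁻ x, cutLow R x = ENNReal.ofReal (2 * R) := by
  have : {x : ℝ | |x| ≤ R} = Set.Icc (-R) R := by
    ext x; simp [abs_le]
  rw [cutLow, this, lintegral_indicator_one measurableSet_Icc, Real.volume_Icc]
  congr 1; ring

@[fun_prop]
lemma omegaBO_meas (α : ℝ) : Measurable (omegaBO α) := by
  unfold omegaBO; fun_prop

lemma inner_bound (α N ξ c : ℝ) (hα0 : 0 < α) (hN : 1 ≤ N) (h : ℝ → ℝ≥0∞) (hh : Measurable h) :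
    ∫⁻ x, cutHigh N (ξ - x) * cutLow (N / 2) x * h (c + resBO α (ξ - x) x)
      ≤ ENNReal.ofReal (2 * N ^ (-(1 + α))) * ∫⁻ t, h t := by
  set s : Set ℝ := Set.Icc (-(N / 2)) (N / 2) ∩ Set.Iic (ξ - N) with hs
  set t : Set ℝ := Set.Icc (-(N / 2)) (N / 2) ∩ Set.Ici (ξ + N) with ht
  have ms : MeasurableSet s := measurableSet_Icc.inter measurableSet_Iic
  have mt : MeasurableSet t := measurableSet_Icc.inter measurableSet_Ici
  set G : ℝ → ℝ≥0∞ := fun x => h (c + resBO α (ξ - x) x) with hG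
  have mG : Measurable G := by
    rw [hG]; unfold resBO; fun_prop
  have b1 : ∫⁻ x in s, G x ≤ ENNReal.ofReal (N ^ (-(1 + α))) * ∫⁻ t, h t := by
    apply subst_one α N ξ c hα0 hN s ms ((convex_Icc _ _).inter (convex_Iic _))
    · rintro x ⟨hx, -⟩; exact abs_le.mpr hx
    · rintro x ⟨-, hx⟩
      have : x ≤ ξ - N := hx
      exact le_trans (by linarith) (le_abs_self _)
  have b2 : ∫⁻ x in t, G x ≤ ENNReal.ofReal (N ^ (-(1 + α))) * ∫⁻ t, h t := by
    apply subst_one α N ξ c hα0 hN t mt ((convex_Icc _ _).inter (convex_Ici _))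
    · rintro x ⟨hx, -⟩; exact abs_le.mpr hx
    · rintro x ⟨-, hx⟩
      have : ξ + N ≤ x := hx
      exact le_trans (by linarith) (neg_le_abs _)
  calc ∫⁻ x, cutHigh N (ξ - x) * cutLow (N / 2) x * G x
      ≤ ∫⁻ x, s.indicator G x + t.indicator G x := by
        apply lintegral_mono
        intro x
        dsimp only
        by_cases p1 : |x| ≤ N / 2
        · by_cases p2 : N ≤ |ξ - x|
          · have e : cutHigh N (ξ - x) * cutLow (N / 2) x * G x = G x := by
              simp [cutHigh, cutLow, p1, p2]
            rw [e]
            rcases le_abs.mp p2 with q | q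
            · have : x ∈ s := ⟨abs_le.mp p1, by simp; linarith⟩
              simp [this]
            · have : x ∈ t := ⟨abs_le.mp p1, by simp; linarith⟩
              simp [this]
          · simp [cutHigh, p2]
        · simp [cutLow, p1]
    _ = (∫⁻ x in s, G x) + ∫⁻ x in t, G x := by
        rw [lintegral_add_left (mG.indicator ms), lintegral_indicator ms, lintegral_indicator mt]
    _ ≤ _ := (add_le_add b1 b2).trans (by
        rw [ENNReal.ofReal_mul (by norm_num), ← two_mul, mul_assoc]; simp)

lemma two_dim (α N c : ℝ) (hα0 : 0 < α) (hN : 1 ≤ N) (H : ℝ × ℝ → ℝ≥0∞) (hH : Measurable H) :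
    ∫⁻ x, ∫⁻ y, cutHigh N x * cutLow (N / 2) y * H (x + y, c + resBO α x y)
      ≤ ENNReal.ofReal (2 * N ^ (-(1 + α))) * ∫⁻ z, H z := by
  rw [lintegral_lintegral_swap (by unfold resBO; fun_prop)]
  calc ∫⁻ y, ∫⁻ x, cutHigh N x * cutLow (N / 2) y * H (x + y, c + resBO α x y)
      = ∫⁻ y, ∫⁻ ξ, cutHigh N (ξ - y) * cutLow (N / 2) y * H (ξ, c + resBO α (ξ - y) y) := by
        apply lintegral_congr
        intro y
        rw [← lintegral_sub_right_eq_self _ y]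
        simp
    _ = ∫⁻ ξ, ∫⁻ y, cutHigh N (ξ - y) * cutLow (N / 2) y * H (ξ, c + resBO α (ξ - y) y) := by
        rw [lintegral_lintegral_swap (by unfold resBO; fun_prop)]
    _ ≤ ∫⁻ ξ, ENNReal.ofReal (2 * N ^ (-(1 + α))) * ∫⁻ τ, H (ξ, τ) := by
        apply lintegral_mono
        intro ξ
        exact inner_bound α N ξ c hα0 hN (fun τ => H (ξ, τ)) (by fun_prop)
    _ = _ := by
        rw [lintegral_const_mul' _ _ ENNReal.ofReal_ne_top, Measure.volume_eq_prod,
          lintegral_prod _ hH.aemeasurable]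

lemma tonelli4 (K : ℝ → ℝ → ℝ → ℝ → ℝ≥0∞)
    (hK : Measurable fun p : ℝ × ℝ × ℝ × ℝ => K p.1 p.2.1 p.2.2.1 p.2.2.2) :
    ∫⁻ w : (ℝ × ℝ) × ℝ × ℝ, K w.1.1 w.1.2 w.2.1 w.2.2
      = ∫⁻ s, ∫⁻ t, ∫⁻ x, ∫⁻ y, K x s y t := by
  have hc : ∀ {β : Type} [MeasurableSpace β] (a b c d : β → ℝ), Measurable a → Measurable b →
      Measurable c → Measurable d → Measurable fun z => K (a z) (b z) (c z) (d z) := by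
    intro β _ a b c d ha hb hc hd
    exact hK.comp (ha.prodMk (hb.prodMk (hc.prodMk hd)))
  have m2 : Measurable fun z : ℝ × ℝ => ∫⁻ w : ℝ × ℝ, K z.1 z.2 w.1 w.2 :=
    Measurable.lintegral_prod_right' (f := fun q : (ℝ × ℝ) × ℝ × ℝ => K q.1.1 q.1.2 q.2.1 q.2.2)
      (hc _ _ _ _ (by fun_prop) (by fun_prop) (by fun_prop) (by fun_prop))
  calc ∫⁻ w : (ℝ × ℝ) × ℝ × ℝ, K w.1.1 w.1.2 w.2.1 w.2.2
      = ∫⁻ z : ℝ × ℝ, ∫⁻ w : ℝ × ℝ, K z.1 z.2 w.1 w.2 := by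
        rw [Measure.volume_eq_prod, lintegral_prod _ (hc _ _ _ _ (by fun_prop) (by fun_prop) (by fun_prop) (by fun_prop)).aemeasurable]
    _ = ∫⁻ s, ∫⁻ x, ∫⁻ w : ℝ × ℝ, K x s w.1 w.2 := by
        exact lintegral_prod_symm (μ := volume) (ν := volume) _ m2.aemeasurable
    _ = ∫⁻ s, ∫⁻ x, ∫⁻ t, ∫⁻ y, K x s y t := by
        apply lintegral_congr; intro s
        apply lintegral_congr; intro x
        rw [Measure.volume_eq_prod, lintegral_prod_symm _ (hc _ _ _ _ (by fun_prop) (by fun_prop) (by fun_prop) (by fun_prop)).aemeasurable]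
    _ = _ := by
        apply lintegral_congr; intro s
        rw [lintegral_lintegral_swap]
        refine (Measurable.lintegral_prod_right' (f := fun q : (ℝ × ℝ) × ℝ => K q.1.1 s q.2 q.1.2)
          ?_).aemeasurable
        exact hc _ _ _ _ (by fun_prop) (by fun_prop) (by fun_prop) (by fun_prop)

lemma four_dim (α N A B : ℝ) (hα0 : 0 < α) (hN : 1 ≤ N) (hA : 0 ≤ A) (hB : 0 ≤ B)
    (H : ℝ × ℝ → ℝ≥0∞) (hH : Measurable H) :
    ∫⁻ w : (ℝ × ℝ) × ℝ × ℝ, cutLow (2 * A) w.1.2 * (cutLow (2 * B) w.2.2 *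
      (cutHigh N w.1.1 * cutLow (N / 2) w.2.1 *
        H (w.1.1 + w.2.1, w.1.2 + w.2.2 + resBO α w.1.1 w.2.1)))
      ≤ ENNReal.ofReal (32 * (A * B * N ^ (-(1 + α)))) * ∫⁻ z, H z := by
  have hne : ∀ R x, cutLow R x ≠ ⊤ := by
    intro R x
    unfold cutLow
    by_cases p : |x| ≤ R <;> simp [p]
  rw [tonelli4 (fun x s y t => cutLow (2 * A) s * (cutLow (2 * B) t *
      (cutHigh N x * cutLow (N / 2) y * H (x + y, s + t + resBO α x y))))
      (by unfold resBO; fun_prop)]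
  calc _ ≤ ∫⁻ s, ∫⁻ t, cutLow (2 * A) s * (cutLow (2 * B) t *
        (ENNReal.ofReal (2 * N ^ (-(1 + α))) * ∫⁻ z, H z)) := by
        apply lintegral_mono; intro s
        apply lintegral_mono; intro t
        dsimp only
        simp_rw [lintegral_const_mul' _ _ (hne _ _)]
        gcongr
        exact two_dim α N (s + t) hα0 hN H hH
    _ = (∫⁻ s, cutLow (2 * A) s) * ((∫⁻ t, cutLow (2 * B) t) *
        (ENNReal.ofReal (2 * N ^ (-(1 + α))) * ∫⁻ z, H z)) := by
        simp_rw [lintegral_const_mul' _ _ (hne _ _)]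
        rw [lintegral_mul_const _ (cutLow_meas _), lintegral_mul_const _ (cutLow_meas _)]
    _ = _ := by
        rw [cutLow_int, cutLow_int, ← mul_assoc, ← mul_assoc, ← ENNReal.ofReal_mul (by positivity),
          ← ENNReal.ofReal_mul (by positivity)]
        congr 2
        ring



/-- High×low interactions, dominant modulation on the output (Lemma 3.2 (a)). -/
theorem stmt7 (α r r' : ℝ) (hα0 : 0 < α) (hα1 : α ≤ 1)
    (hr1 : 1 < r) (hr2 : r ≤ 2) (hconj : 1 / r + 1 / r' = 1) :
    ∃ C > (0 : ℝ), ∀ N₁ N₂ N L₁ L₂ L : ℝ,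
      1 ≤ N₁ → 1 ≤ N₂ → 1 ≤ N → 1 ≤ L₁ → 1 ≤ L₂ → 1 ≤ L →
      4 * N₂ ≤ N₁ → L = max L (max L₁ L₂) →
      ∀ f₁ f₂ f : ℝ × ℝ → ℝ,
        Measurable f₁ → (∀ z, 0 ≤ f₁ z) → Function.support f₁ ⊆ Dset N₁ L₁ →
        Measurable f₂ → (∀ z, 0 ≤ f₂ z) → Function.support f₂ ⊆ Dset N₂ L₂ →
        Measurable f → (∀ z, 0 ≤ f z) → Function.support f ⊆ Dset N L →
        Jfun α f₁ f₂ f ≤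
          ENNReal.ofReal (C * (L₁ ^ (1 / r) * L₂ ^ (1 / r) * N₁ ^ (-(1 + α) / r))) *
            (LpN r' f₁ * LpN r' f₂ * LpN r f) := by
  have hr0 : 0 < r := by linarith
  have hinv : 1 / r < 1 := by rw [div_lt_one hr0]; exact hr1
  have hr'0 : 0 < r' := by
    have : 0 < 1 / r' := by linarith
    exact one_div_pos.mp this
  have hpq : r'.HolderConjugate r := by
    rw [Real.holderConjugate_iff]
    refine ⟨?_, by simp only [one_div] at hconj; linarith⟩
    have h0 : 0 < 1 / r := by positivity
    have : 1 / r' < 1 := by linarith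
    rwa [div_lt_one hr'0] at this
  refine ⟨32 ^ (1 / r), by positivity, ?_⟩
  intro N₁ N₂ N L₁ L₂ L hN₁ hN₂ hN hL₁ hL₂ hL hNN hLL f₁ f₂ f mf₁ pf₁ sf₁ mf₂ pf₂ sf₂ mf pf sf
  set F₁ : ℝ × ℝ → ℝ≥0∞ := fun z => ENNReal.ofReal (f₁ z) with hF₁
  set F₂ : ℝ × ℝ → ℝ≥0∞ := fun z => ENNReal.ofReal (f₂ z) with hF₂
  set F : ℝ × ℝ → ℝ≥0∞ := fun z => ENNReal.ofReal (f z) with hF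
  have mF₁ : Measurable F₁ := by fun_prop
  have mF₂ : Measurable F₂ := by fun_prop
  have mF : Measurable F := by fun_prop
  set X : (ℝ × ℝ) × ℝ × ℝ → ℝ≥0∞ := fun w => F₁ w.1 * F₂ w.2 with hX
  set Y : (ℝ × ℝ) × ℝ × ℝ → ℝ≥0∞ := fun w => cutLow (2 * L₁) w.1.2 * (cutLow (2 * L₂) w.2.2 *
      (cutHigh N₁ w.1.1 * cutLow (N₁ / 2) w.2.1 *
        F (w.1.1 + w.2.1, w.1.2 + w.2.2 + resBO α w.1.1 w.2.1))) with hY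
  have mX : Measurable X := by fun_prop
  have mY : Measurable Y := by rw [hY]; unfold resBO; fun_prop
  have cutr : ∀ R x, cutLow R x ^ r = cutLow R x := by
    intro R x
    unfold cutLow
    by_cases p : |x| ≤ R <;> simp [p, hr0]
  have cutr' : ∀ R x, cutHigh R x ^ r = cutHigh R x := by
    intro R x
    unfold cutHigh
    by_cases p : R ≤ |x| <;> simp [p, hr0]
  have hJ : Jfun α f₁ f₂ f ≤ ∫⁻ w, (X * Y) w := by
    unfold Jfun
    apply lintegral_mono
    intro w
    by_cases h1 : f₁ w.1 = 0
    · simp [h1]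
    by_cases h2 : f₂ w.2 = 0
    · simp [h2]
    obtain ⟨a1, a2, a3, a4⟩ := sf₁ h1
    obtain ⟨b1, b2, b3, b4⟩ := sf₂ h2
    have b5 : |w.2.1| ≤ N₁ / 2 := by linarith
    have : Y w = F (w.1.1 + w.2.1, w.1.2 + w.2.2 + resBO α w.1.1 w.2.1) := by
      simp [hY, cutLow, cutHigh, a1, a4, b4, b5]
    rw [Pi.mul_apply, this]
    simp only [hX, hF₁, hF₂, hF]
    rw [ENNReal.ofReal_mul (mul_nonneg (pf₁ _) (pf₂ _)), ENNReal.ofReal_mul (pf₁ _)]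
  have hXp : (∫⁻ w, X w ^ r') ^ (1 / r') = LpN r' f₁ * LpN r' f₂ := by
    unfold LpN
    rw [← ENNReal.mul_rpow_of_nonneg _ _ (by positivity)]
    congr 1
    simp only [hX]
    simp_rw [ENNReal.mul_rpow_of_nonneg _ _ hr'0.le]
    rw [Measure.volume_eq_prod, lintegral_prod_mul (f := fun z => F₁ z ^ r') (g := fun z => F₂ z ^ r')
      (by fun_prop) (by fun_prop)]
  have hYp : (∫⁻ w, Y w ^ r) ^ (1 / r) ≤
      ENNReal.ofReal (32 ^ (1 / r) * (L₁ ^ (1 / r) * L₂ ^ (1 / r) * N₁ ^ (-(1 + α) / r)))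
        * LpN r f := by
    have hb := four_dim α N₁ L₁ L₂ hα0 hN₁ (by linarith) (by linarith) (fun z => F z ^ r)
      (by fun_prop)
    have e : ∀ w, Y w ^ r = cutLow (2 * L₁) w.1.2 * (cutLow (2 * L₂) w.2.2 *
      (cutHigh N₁ w.1.1 * cutLow (N₁ / 2) w.2.1 *
        F (w.1.1 + w.2.1, w.1.2 + w.2.2 + resBO α w.1.1 w.2.1) ^ r)) := by
      intro w
      simp only [hY, ENNReal.mul_rpow_of_nonneg _ _ hr0.le, cutr, cutr']
    simp_rw [e]
    refine (ENNReal.rpow_le_rpow hb (by positivity)).trans (le_of_eq ?_)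
    have hN₁0 : 0 ≤ N₁ := by linarith
    have hL₁0 : 0 ≤ L₁ := by linarith
    have hL₂0 : 0 ≤ L₂ := by linarith
    rw [ENNReal.mul_rpow_of_nonneg _ _ (by positivity),
      ENNReal.ofReal_rpow_of_nonneg (by positivity) (by positivity),
      Real.mul_rpow (by norm_num) (by positivity), Real.mul_rpow (by positivity) (by positivity),
      Real.mul_rpow hL₁0 hL₂0, ← Real.rpow_mul hN₁0, mul_one_div]
    rfl
  calc Jfun α f₁ f₂ f ≤ ∫⁻ w, (X * Y) w := hJ
    _ ≤ (∫⁻ w, X w ^ r') ^ (1 / r') * (∫⁻ w, Y w ^ r) ^ (1 / r) :=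
        ENNReal.lintegral_mul_le_Lp_mul_Lq _ hpq mX.aemeasurable mY.aemeasurable
    _ ≤ _ := by
        rw [hXp]
        refine (mul_le_mul_right hYp _).trans (le_of_eq ?_)
        ring
end

section
/- (High×high interactions with opposite signs, dominant modulation on the output.) Let 0 < α ≤ 1 and 1 < r ≤ 2 with conjugate exponent r′. There exists C > 0 (depending only on α and r) such that for all parameters N₁, N₂, N, L₁, L₂, L ≥ 1 with N₁/2 ≤ N₂ ≤ 2N₁ and L = max{L, L₁, L₂}, and all nonnegative measurable functions f₁, f₂ ∈ L^{r′}(ℝ²) with supp f₁ ⊂ D_{N₁,L₁} ∩ {ξ₁ > 0}, supp f₂ ⊂ D_{N₂,L₂} ∩ {ξ₂ < 0}, and nonnegative f ∈ L^r(ℝ²) with supp f ⊂ D_{N,L}, one has J(f₁,f₂,f) ≤ C L₁^{1/r} L₂^{1/r} (N₁^α N)^{−1/r} ‖f₁‖_{L^{r′}} ‖f₂‖_{L^{r′}} ‖f‖_{L^r}. -/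
open MeasureTheory ENNReal

lemma deriv_bd (α N₁ N ξ x : ℝ) (hα : 0 < α) (hN₁ : 1 ≤ N₁) (hN : 1 ≤ N) (hξ : N ≤ |ξ|)
    (hx : N₁ ≤ x) (hxξ : ξ ≤ x) :
    N₁ ^ α * N ≤ |(2+α) * ((x-ξ)^(1+α) - x^(1+α))| := by
  have key : ∀ a b : ℝ, 0 ≤ b → b ≤ a → N₁ ≤ a → N ≤ a - b →
      N₁ ^ α * N ≤ a^(1+α) - b^(1+α) := by
    intro a b hb hab ha hN'
    have ha0 : 0 < a := by linarith
    have e1 : a^(1+α) = a * a^α := by rw [Real.rpow_add ha0, Real.rpow_one]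
    have e2 : b^(1+α) = b * b^α := by
      rw [Real.rpow_add' hb (by positivity), Real.rpow_one]
    have h1 : b^α ≤ a^α := Real.rpow_le_rpow hb hab hα.le
    have h2 : N₁^α ≤ a^α := Real.rpow_le_rpow (by linarith) ha hα.le
    have h3 : N₁ ^ α * N ≤ a^α * (a-b) := by gcongr
    rw [e1, e2]
    nlinarith
  rw [abs_mul, abs_of_pos (by positivity : 0 < 2+α)]
  have h4 : N₁ ^ α * N ≤ |(x-ξ)^(1+α) - x^(1+α)| := by
    rcases le_total 0 ξ with h | h
    · rw [abs_of_nonneg h] at hξ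
      rw [abs_sub_comm]
      exact (key x (x-ξ) (by linarith) (by linarith) hx (by linarith)).trans (le_abs_self _)
    · rw [abs_of_nonpos h] at hξ
      exact (key (x-ξ) x (by linarith) (by linarith) (by linarith) (by linarith)).trans
        (le_abs_self _)
  nlinarith [abs_nonneg ((x-ξ)^(1+α) - x^(1+α))]

lemma cov (α N₁ N ξ c : ℝ) (hα : 0 < α) (hN₁ : 1 ≤ N₁) (hN : 1 ≤ N) (hξ : N ≤ |ξ|)
    (G : ℝ → ℝ≥0∞) :
    ENNReal.ofReal (N₁ ^ α * N) *
      ∫⁻ x in Set.Ici (max N₁ ξ), G (c + ((x-ξ)^(2+α) - x^(2+α))) ≤ ∫⁻ y, G y := by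
  set s := Set.Ici (max N₁ ξ) with hs
  set g : ℝ → ℝ := fun x => c + ((x-ξ)^(2+α) - x^(2+α)) with hg
  set g' : ℝ → ℝ := fun x => (2+α) * ((x-ξ)^(1+α) - x^(1+α)) with hg'
  have hd : ∀ x, HasDerivAt g (g' x) x := by
    intro x
    have h1 : HasDerivAt (fun x : ℝ => (x-ξ)^(2+α)) (1 * (2+α) * (x-ξ)^(2+α-1)) x :=
      ((hasDerivAt_id x).sub_const ξ).rpow_const (Or.inr (by linarith))
    have h2 : HasDerivAt (fun x : ℝ => x^(2+α)) (1 * (2+α) * x^(2+α-1)) x :=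
      (hasDerivAt_id x).rpow_const (Or.inr (by linarith))
    refine ((h1.sub h2).const_add c).congr_deriv ?_
    simp only [hg']
    rw [show 2+α-1 = 1+α by ring]; ring
  have hbd : ∀ x ∈ s, N₁ ^ α * N ≤ |g' x| := fun x hx => by
    have hx' : max N₁ ξ ≤ x := hx
    exact deriv_bd α N₁ N ξ x hα hN₁ hN hξ ((le_max_left _ _).trans hx') ((le_max_right _ _).trans hx')
  have hpos : 0 < N₁ ^ α * N := by
    have : 0 < N₁ := by linarith
    positivity
  have hinj : Set.InjOn g s := by
    intro x hx y hy hxy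
    by_contra hne
    have main : ∀ x ∈ s, ∀ y ∈ s, g x = g y → x < y → False := by
      intro x hx y hy hxy hlt
      obtain ⟨z, hz, hz0⟩ := exists_hasDerivAt_eq_zero hlt
        (fun t _ => (hd t).continuousAt.continuousWithinAt) hxy (fun t _ => hd t)
      have := hbd z (le_trans hx hz.1.le)
      rw [hz0, abs_zero] at this
      linarith
    rcases lt_or_gt_of_ne hne with h | h
    · exact main x hx y hy hxy h
    · exact main y hy x hx hxy.symm h
  have hms : MeasurableSet s := measurableSet_Ici
  calc ENNReal.ofReal (N₁ ^ α * N) * ∫⁻ x in s, G (g x)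
      = ∫⁻ x in s, ENNReal.ofReal (N₁ ^ α * N) * G (g x) := by
        rw [lintegral_const_mul' _ _ ofReal_ne_top]
    _ ≤ ∫⁻ x in s, ENNReal.ofReal |g' x| * G (g x) := by
        refine setLIntegral_mono' hms fun x hx => ?_
        gcongr
        exact hbd x hx
    _ = ∫⁻ y in g '' s, G y :=
        (lintegral_image_eq_lintegral_abs_deriv_mul hms (fun x _ => (hd x).hasDerivWithinAt) hinj G).symm
    _ ≤ ∫⁻ y, G y := setLIntegral_le_lintegral _ _

lemma res_eq (α ξ x : ℝ) (hα : 0 < α) (hx : 0 < x) (hxξ : ξ ≤ x) :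
    resBO α x (ξ - x) = -omegaBO α ξ + ((x-ξ)^(2+α) - x^(2+α)) := by
  unfold resBO
  rw [show x + (ξ - x) = ξ by ring]
  have e1 : omegaBO α x = - x^(2+α) := by
    unfold omegaBO
    rw [abs_of_pos hx, show 2+α = 1 + (1+α) by ring, Real.rpow_add hx 1 (1+α), Real.rpow_one]; ring
  have e2 : omegaBO α (ξ - x) = (x-ξ)^(2+α) := by
    unfold omegaBO
    rw [abs_of_nonpos (by linarith), show 2+α = 1 + (1+α) by ring,
      Real.rpow_add' (by linarith : 0 ≤ x-ξ) (by positivity), Real.rpow_one]; ring_nf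
  rw [e1, e2]; ring

lemma meas_res (α : ℝ) : Measurable (fun p : ℝ × ℝ => resBO α p.1 p.2) := by
  unfold resBO omegaBO
  fun_prop

lemma meas_A (N₁ N : ℝ) :
    MeasurableSet {p : ℝ × ℝ | N₁ ≤ p.1 ∧ p.2 ≤ 0 ∧ N ≤ |p.1 + p.2|} := by
  have h1 : MeasurableSet {p : ℝ × ℝ | N₁ ≤ p.1} :=
    measurableSet_le measurable_const measurable_fst
  have h2 : MeasurableSet {p : ℝ × ℝ | p.2 ≤ 0} :=
    measurableSet_le measurable_snd measurable_const
  have h3 : MeasurableSet {p : ℝ × ℝ | N ≤ |p.1 + p.2|} :=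
    measurableSet_le measurable_const (by fun_prop)
  exact h1.inter (h2.inter h3)

lemma inner_bd (α N₁ N s : ℝ) (hα : 0 < α) (hN₁ : 1 ≤ N₁) (hN : 1 ≤ N)
    (F : ℝ × ℝ → ℝ≥0∞) (hF : Measurable F) (A : Set (ℝ × ℝ))
    (hA : A = {p | N₁ ≤ p.1 ∧ p.2 ≤ 0 ∧ N ≤ |p.1 + p.2|}) :
    ENNReal.ofReal (N₁ ^ α * N) *
      ∫⁻ p : ℝ × ℝ, A.indicator (fun p => F (p.1 + p.2, s + resBO α p.1 p.2)) p
      ≤ ∫⁻ z, F z := by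
  have hAm : MeasurableSet A := by
    rw [hA]
    exact meas_A N₁ N
  have hres := meas_res α
  set Φ := A.indicator (fun p : ℝ × ℝ => F (p.1 + p.2, s + resBO α p.1 p.2)) with hΦ
  have hΦm : Measurable Φ := Measurable.indicator (by fun_prop) hAm
  have e : ∫⁻ p, Φ p = ∫⁻ ξ : ℝ, ∫⁻ x : ℝ, Φ (x, ξ - x) := by
    rw [Measure.volume_eq_prod, lintegral_prod _ hΦm.aemeasurable,
      ← lintegral_lintegral_swap (f := fun x ξ => Φ (x, ξ - x))
        (by unfold Function.uncurry; exact (hΦm.comp (by fun_prop)).aemeasurable)]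
    refine lintegral_congr fun x => ?_
    exact (lintegral_sub_right_eq_self (fun y => Φ (x, y)) x).symm
  rw [e, ← lintegral_const_mul' _ _ ofReal_ne_top, Measure.volume_eq_prod,
    lintegral_prod _ hF.aemeasurable]
  refine lintegral_mono fun ξ => ?_
  by_cases hξ : N ≤ |ξ|
  · refine le_trans ?_ (cov α N₁ N ξ (s - omegaBO α ξ) hα hN₁ hN hξ (fun y => F (ξ, y)))
    refine mul_le_mul_right ?_ _
    rw [← lintegral_indicator measurableSet_Ici]
    refine lintegral_mono fun x => ?_
    by_cases hx : (x, ξ - x) ∈ A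
    · have hx' := hx
      rw [hA] at hx'
      obtain ⟨h1, h2, h3⟩ := hx'
      simp only at h1 h2 h3
      have hm : x ∈ Set.Ici (max N₁ ξ) := max_le h1 (by linarith)
      rw [hΦ, Set.indicator_of_mem hx, Set.indicator_of_mem hm]
      simp only
      rw [res_eq α ξ x hα (by linarith) (by linarith)]
      apply le_of_eq
      congr 2 <;> ring
    · rw [hΦ, Set.indicator_of_notMem hx]
      exact zero_le
  · have : ∀ x, Φ (x, ξ - x) = 0 := by
      intro x
      apply Set.indicator_of_notMem
      rw [hA]
      rintro ⟨-, -, h⟩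
      simp only [add_sub_cancel] at h
      exact hξ h
    simp [this]

lemma perm_int (H : (ℝ × ℝ) × ℝ × ℝ → ℝ≥0∞) (hH : Measurable H) :
    ∫⁻ w, H w = ∫⁻ σ : ℝ × ℝ, ∫⁻ p : ℝ × ℝ, H ((p.1, σ.1), (p.2, σ.2)) := by
  have m1 : ∀ a : ℝ, Measurable fun p : ℝ × ℝ × ℝ => H ((a, p.1), (p.2.1, p.2.2)) :=
    fun a => hH.comp (by fun_prop)
  calc ∫⁻ w, H w = ∫⁻ z₁ : ℝ × ℝ, ∫⁻ z₂ : ℝ × ℝ, H (z₁, z₂) := by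
        rw [Measure.volume_eq_prod, lintegral_prod _ hH.aemeasurable]
    _ = ∫⁻ z₁ : ℝ × ℝ, ∫⁻ ξ₂ : ℝ, ∫⁻ σ₂ : ℝ, H (z₁, (ξ₂, σ₂)) := by
        refine lintegral_congr fun z₁ => ?_
        rw [Measure.volume_eq_prod, lintegral_prod _ (by fun_prop)]
    _ = ∫⁻ z₁ : ℝ × ℝ, ∫⁻ σ₂ : ℝ, ∫⁻ ξ₂ : ℝ, H (z₁, (ξ₂, σ₂)) := by
        refine lintegral_congr fun z₁ => ?_
        rw [lintegral_lintegral_swap (by unfold Function.uncurry; fun_prop)]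
    _ = ∫⁻ ξ₁ : ℝ, ∫⁻ σ₁ : ℝ, ∫⁻ σ₂ : ℝ, ∫⁻ ξ₂ : ℝ, H ((ξ₁, σ₁), (ξ₂, σ₂)) := by
        rw [Measure.volume_eq_prod, lintegral_prod]
        refine Measurable.aemeasurable ?_
        refine Measurable.lintegral_prod_right' (f := fun q : (ℝ × ℝ) × ℝ => ∫⁻ ξ₂ : ℝ, H (q.1, (ξ₂, q.2))) ?_
        exact Measurable.lintegral_prod_right'
          (f := fun q : ((ℝ × ℝ) × ℝ) × ℝ => H (q.1.1, (q.2, q.1.2))) (hH.comp (by fun_prop))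
    _ = ∫⁻ ξ₁ : ℝ, ∫⁻ σ : ℝ × ℝ, ∫⁻ ξ₂ : ℝ, H ((ξ₁, σ.1), (ξ₂, σ.2)) := by
        refine lintegral_congr fun ξ₁ => ?_
        rw [Measure.volume_eq_prod, lintegral_prod]
        refine Measurable.aemeasurable ?_
        exact Measurable.lintegral_prod_right'
          (f := fun q : (ℝ × ℝ) × ℝ => H ((ξ₁, q.1.1), (q.2, q.1.2))) (hH.comp (by fun_prop))
    _ = ∫⁻ σ : ℝ × ℝ, ∫⁻ ξ₁ : ℝ, ∫⁻ ξ₂ : ℝ, H ((ξ₁, σ.1), (ξ₂, σ.2)) := by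
        rw [lintegral_lintegral_swap]
        refine Measurable.aemeasurable ?_
        exact Measurable.lintegral_prod_right'
          (f := fun q : (ℝ × ℝ × ℝ) × ℝ => H ((q.1.1, q.1.2.1), (q.2, q.1.2.2)))
          (hH.comp (by fun_prop))
    _ = _ := by
        refine lintegral_congr fun σ => ?_
        rw [Measure.volume_eq_prod,
          lintegral_prod (f := fun p : ℝ × ℝ => H ((p.1, σ.1), (p.2, σ.2)))]
        exact (hH.comp (by fun_prop)).aemeasurable

theorem stmt9 (α r r' : ℝ) (hα0 : 0 < α) (hα1 : α ≤ 1)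
    (hr1 : 1 < r) (hr2 : r ≤ 2) (hconj : 1 / r + 1 / r' = 1) :
    ∃ C > (0 : ℝ), ∀ N₁ N₂ N L₁ L₂ L : ℝ,
      1 ≤ N₁ → 1 ≤ N₂ → 1 ≤ N → 1 ≤ L₁ → 1 ≤ L₂ → 1 ≤ L →
      N₁ / 2 ≤ N₂ → N₂ ≤ 2 * N₁ → L = max L (max L₁ L₂) →
      ∀ f₁ f₂ f : ℝ × ℝ → ℝ,
        Measurable f₁ → (∀ z, 0 ≤ f₁ z) →
        Function.support f₁ ⊆ Dset N₁ L₁ ∩ {z : ℝ × ℝ | 0 < z.1} →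
        Measurable f₂ → (∀ z, 0 ≤ f₂ z) →
        Function.support f₂ ⊆ Dset N₂ L₂ ∩ {z : ℝ × ℝ | z.1 < 0} →
        Measurable f → (∀ z, 0 ≤ f z) → Function.support f ⊆ Dset N L →
        Jfun α f₁ f₂ f ≤
          ENNReal.ofReal (C * (L₁ ^ (1 / r) * L₂ ^ (1 / r) * (N₁ ^ α * N) ^ (-(1 / r)))) *
            (LpN r' f₁ * LpN r' f₂ * LpN r f) := by
  refine ⟨16 ^ (1/r), by positivity, ?_⟩
  intro N₁ N₂ N L₁ L₂ L hN₁ hN₂ hN hL₁ hL₂ hL _ _ _ f₁ f₂ f mf₁ pf₁ sf₁ mf₂ pf₂ sf₂ mf pf sf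
  have hr0 : 0 < r := by linarith
  have hpq : r.HolderConjugate r' :=
    Real.holderConjugate_iff.2 ⟨hr1, by simpa only [one_div] using hconj⟩
  have hr'0 : 0 < r' := hpq.symm.pos
  have hN₁0 : 0 < N₁ := by linarith
  set K := N₁ ^ α * N with hK
  have hK0 : 0 < K := by positivity
  have hres := meas_res α
  set A : Set (ℝ × ℝ) := {p | N₁ ≤ p.1 ∧ p.2 ≤ 0 ∧ N ≤ |p.1 + p.2|} with hA
  have hAm : MeasurableSet A := by
    rw [hA]
    exact meas_A N₁ N
  set B : Set (ℝ × ℝ) := Set.Icc (-(2*L₁)) (2*L₁) ×ˢ Set.Icc (-(2*L₂)) (2*L₂) with hB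
  have hBm : MeasurableSet B := measurableSet_Icc.prod measurableSet_Icc
  have hBv : volume B = ENNReal.ofReal (16 * L₁ * L₂) := by
    rw [hB, Measure.volume_eq_prod, Measure.prod_prod, Real.volume_Icc, Real.volume_Icc,
      ← ENNReal.ofReal_mul (by linarith)]
    congr 1; ring
  set S : Set ((ℝ × ℝ) × ℝ × ℝ) := {w | (w.1.1, w.2.1) ∈ A ∧ (w.1.2, w.2.2) ∈ B} with hS
  have hSm : MeasurableSet S := by
    have h1 : Measurable fun w : (ℝ × ℝ) × ℝ × ℝ => (w.1.1, w.2.1) := by fun_prop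
    have h2 : Measurable fun w : (ℝ × ℝ) × ℝ × ℝ => (w.1.2, w.2.2) := by fun_prop
    exact (h1 hAm).inter (h2 hBm)
  have mT : Measurable fun w : (ℝ × ℝ) × ℝ × ℝ =>
      (w.1.1 + w.2.1, w.1.2 + w.2.2 + resBO α w.1.1 w.2.1) := by
    have : Measurable fun w : (ℝ × ℝ) × ℝ × ℝ => resBO α w.1.1 w.2.1 :=
      hres.comp (f := fun w : (ℝ × ℝ) × ℝ × ℝ => (w.1.1, w.2.1)) (by fun_prop)
    fun_prop
  set u : (ℝ × ℝ) × ℝ × ℝ → ℝ≥0∞ := fun w => ENNReal.ofReal (f₁ w.1) * ENNReal.ofReal (f₂ w.2)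
    with hu
  set v : (ℝ × ℝ) × ℝ × ℝ → ℝ≥0∞ := S.indicator (fun w => ENNReal.ofReal
      (f (w.1.1 + w.2.1, w.1.2 + w.2.2 + resBO α w.1.1 w.2.1))) with hv
  have hum : Measurable u := by fun_prop
  have hvm : Measurable v := (mf.comp mT).ennreal_ofReal.indicator hSm
  have hJ : Jfun α f₁ f₂ f ≤ ∫⁻ w, (u * v) w := by
    refine lintegral_mono fun w => ?_
    simp only [Pi.mul_apply, hu]
    rw [ENNReal.ofReal_mul (mul_nonneg (pf₁ _) (pf₂ _)), ENNReal.ofReal_mul (pf₁ _)]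
    by_cases h1 : f₁ w.1 = 0
    · simp [h1]
    by_cases h2 : f₂ w.2 = 0
    · simp [h2]
    by_cases h3 : f (w.1.1 + w.2.1, w.1.2 + w.2.2 + resBO α w.1.1 w.2.1) = 0
    · simp [h3]
    obtain ⟨⟨a1, a2, a3, a4⟩, a5⟩ := sf₁ h1
    obtain ⟨⟨b1, b2, b3, b4⟩, b5⟩ := sf₂ h2
    obtain ⟨c1, c2, c3, c4⟩ := sf h3
    have a5' : 0 < w.1.1 := a5
    have b5' : w.2.1 < 0 := b5
    rw [abs_of_pos a5'] at a1
    have hw : w ∈ S := ⟨⟨a1, b5'.le, c1⟩, abs_le.1 a4, abs_le.1 b4⟩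
    rw [hv, Set.indicator_of_mem hw]
  have hU : (∫⁻ w, u w ^ r') ^ (1/r') = LpN r' f₁ * LpN r' f₂ := by
    unfold LpN
    rw [← ENNReal.mul_rpow_of_nonneg _ _ (by positivity)]
    congr 1
    rw [Measure.volume_eq_prod, ← lintegral_prod_mul (by fun_prop) (by fun_prop)]
    refine lintegral_congr fun w => ?_
    simp only [hu]
    rw [ENNReal.mul_rpow_of_nonneg _ _ hr'0.le]
  set F : ℝ × ℝ → ℝ≥0∞ := fun z => ENNReal.ofReal (f z) ^ r with hF
  have hFm : Measurable F := by fun_prop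
  have hV : ∫⁻ w, v w ^ r ≤ ENNReal.ofReal (16 * L₁ * L₂ * K⁻¹) * ∫⁻ z, F z := by
    rw [perm_int _ (by fun_prop)]
    calc ∫⁻ σ : ℝ × ℝ, ∫⁻ p : ℝ × ℝ, v ((p.1, σ.1), (p.2, σ.2)) ^ r
        ≤ ∫⁻ σ : ℝ × ℝ, B.indicator (fun _ => ENNReal.ofReal K⁻¹ * ∫⁻ z, F z) σ := by
          refine lintegral_mono fun σ => ?_
          by_cases hσ : σ ∈ B
          · rw [Set.indicator_of_mem hσ]
            have h := inner_bd α N₁ N (σ.1 + σ.2) hα0 hN₁ hN F hFm A hA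
            rw [← hK] at h
            have e : ∀ p : ℝ × ℝ, v ((p.1, σ.1), (p.2, σ.2)) ^ r =
                A.indicator (fun p => F (p.1 + p.2, σ.1 + σ.2 + resBO α p.1 p.2)) p := by
              intro p
              by_cases hp : p ∈ A
              · have : ((p.1, σ.1), (p.2, σ.2)) ∈ S := ⟨hp, hσ⟩
                rw [hv, Set.indicator_of_mem this, Set.indicator_of_mem hp]
              · have : ((p.1, σ.1), (p.2, σ.2)) ∉ S := fun h => hp h.1
                rw [hv, Set.indicator_of_notMem this, Set.indicator_of_notMem hp,
                  ENNReal.zero_rpow_of_pos hr0]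
            simp_rw [e]
            calc _ = ENNReal.ofReal K⁻¹ * (ENNReal.ofReal K * ∫⁻ p : ℝ × ℝ, A.indicator
                (fun p => F (p.1 + p.2, σ.1 + σ.2 + resBO α p.1 p.2)) p) := by
                  rw [← mul_assoc, ← ENNReal.ofReal_mul (by positivity), inv_mul_cancel₀ hK0.ne',
                    ENNReal.ofReal_one, one_mul]
              _ ≤ _ := by gcongr
          · have : ∀ p : ℝ × ℝ, v ((p.1, σ.1), (p.2, σ.2)) ^ r = 0 := by
              intro p
              have : ((p.1, σ.1), (p.2, σ.2)) ∉ S := fun h => hσ h.2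
              rw [hv, Set.indicator_of_notMem this, ENNReal.zero_rpow_of_pos hr0]
            simp [this]
      _ = _ := by
          rw [lintegral_indicator hBm, setLIntegral_const, hBv,
            ENNReal.ofReal_mul (p := 16 * L₁ * L₂) (by positivity)]
          ring
  have hC : ENNReal.ofReal (16 * L₁ * L₂ * K⁻¹) ^ (1/r) =
      ENNReal.ofReal (16 ^ (1/r) * (L₁ ^ (1 / r) * L₂ ^ (1 / r) * K ^ (-(1 / r)))) := by
    rw [ENNReal.ofReal_rpow_of_nonneg (by positivity) (by positivity),
      Real.mul_rpow (by positivity) (by positivity), Real.mul_rpow (by positivity) (by positivity),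
      Real.mul_rpow (by positivity) (by positivity), Real.inv_rpow hK0.le, Real.rpow_neg hK0.le]
    congr 1; ring
  calc Jfun α f₁ f₂ f ≤ ∫⁻ w, (u * v) w := hJ
    _ ≤ (∫⁻ w, u w ^ r') ^ (1/r') * (∫⁻ w, v w ^ r) ^ (1/r) :=
        ENNReal.lintegral_mul_le_Lp_mul_Lq _ hpq.symm hum.aemeasurable hvm.aemeasurable
    _ ≤ (LpN r' f₁ * LpN r' f₂) *
        (ENNReal.ofReal (16 * L₁ * L₂ * K⁻¹) * ∫⁻ z, F z) ^ (1/r) := by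
        rw [hU]; gcongr
    _ = _ := by
        rw [ENNReal.mul_rpow_of_nonneg _ _ (by positivity), hC]
        unfold LpN
        ring
end

section
/- (High×high → low interactions, dominant modulation on an input.) Let 0 < α ≤ 1 and 1 < r ≤ 2 with conjugate exponent r′. There exists C > 0 (depending only on α and r) such that for all parameters N₁, N₂, N, L₁, L₂, L ≥ 1 with N₁/2 ≤ N₂ ≤ 2N₁ and N ≤ N₁/8, for each i ∈ {1,2} with L_i = max{L, L₁, L₂}, and all nonnegative measurable functions f₁, f₂ ∈ L^{r′}(ℝ²) with supp f₁ ⊂ D_{N₁,L₁}, supp f₂ ⊂ D_{N₂,L₂}, and nonnegative f ∈ L^r(ℝ²) with supp f ⊂ D_{N,L}, one has J(f₁,f₂,f) ≤ C L₁^{1/r} L₂^{1/r} L^{1/r′} L_i^{−1/r} N₁^{1/r−1/r′} N₁^{−(1+α)/r′} ‖f₁‖_{L^{r′}} ‖f₂‖_{L^{r′}} ‖f‖_{L^r}. -/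
open MeasureTheory ENNReal

lemma hasDeriv_h (p t : ℝ) (hp : 1 < p) :
    HasDerivAt (fun t : ℝ => t * |t| ^ p) ((1 + p) * |t| ^ p) t := by
  have h := (hasDerivAt_id t).mul (hasDerivAt_abs_rpow t hp)
  refine h.congr_deriv ?_
  by_cases ht : t = 0
  · subst ht
    simp [Real.zero_rpow (by linarith : p ≠ 0)]
  · have h0 : 0 < |t| := abs_pos.mpr ht
    have : |t| ^ p = |t| ^ (p - 2) * t ^ 2 := by
      rw [← sq_abs t, ← Real.rpow_natCast, ← Real.rpow_add h0]
      norm_num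
    simp only [id]
    rw [this]; ring

lemma monoBO (α x M y y' : ℝ) (hα0 : 0 < α) (hM : 0 < M)
    (h : y ≤ y') (hy : ∀ z ∈ Set.Icc y y', M / 2 ≤ |z|)
    (hxy : |x + y| ≤ M / 4) (hxy' : |x + y'| ≤ M / 4) :
    (M / 2) ^ (1 + α) * (y' - y) ≤ resBO α x y - resBO α x y' := by
  have hd : ∀ z : ℝ, HasDerivAt (fun z : ℝ => z * |z| ^ (1 + α) - (x + z) * |x + z| ^ (1 + α))
      ((1 + (1 + α)) * |z| ^ (1 + α) - (1 + (1 + α)) * |x + z| ^ (1 + α)) z := by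
    intro z
    have h1 := hasDeriv_h (1 + α) z (by linarith)
    have h2 := hasDeriv_h (1 + α) (x + z) (by linarith)
    have h3 := h2.comp_const_add x z
    exact h1.sub h3
  have key := (convex_Icc y y').mul_sub_le_image_sub_of_le_deriv
    (f := fun z : ℝ => z * |z| ^ (1 + α) - (x + z) * |x + z| ^ (1 + α))
    (C := (M / 2) ^ (1 + α))
    (fun z _ => (hd z).continuousAt.continuousWithinAt)
    (fun z _ => (hd z).differentiableAt.differentiableWithinAt)
    (by
      intro z hz
      have hz := interior_subset hz
      rw [(hd z).deriv]
      have a1 : (M / 2) ^ (1 + α) ≤ |z| ^ (1 + α) :=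
        Real.rpow_le_rpow (by positivity) (hy z hz) (by linarith)
      have a2 : |x + z| ≤ M / 4 := by
        rw [abs_le] at *
        constructor <;> linarith [hz.1, hz.2]
      have a3 : |x + z| ^ (1 + α) ≤ (M / 4) ^ (1 + α) :=
        Real.rpow_le_rpow (by positivity) a2 (by linarith)
      have a4 : (M / 4) ^ (1 + α) ≤ (M / 2) ^ (1 + α) / 2 := by
        have e : M / 4 = (M / 2) * (1 / 2) := by ring
        rw [e, Real.mul_rpow (by positivity) (by positivity)]
        have : (1 / 2 : ℝ) ^ (1 + α) ≤ (1 / 2 : ℝ) ^ (1 : ℝ) :=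
          Real.rpow_le_rpow_of_exponent_ge (by norm_num) (by norm_num) (by linarith)
        rw [Real.rpow_one] at this
        have h0 : 0 ≤ (M / 2) ^ (1 + α) := by positivity
        nlinarith
      have h0 : 0 ≤ (M / 2) ^ (1 + α) := by positivity
      nlinarith)
    y (Set.left_mem_Icc.mpr h) y' (Set.right_mem_Icc.mpr h) h
  simp only [resBO, omegaBO]
  linarith

lemma sliceBO (α x M L c : ℝ) (hα0 : 0 < α) (hα1 : α ≤ 1) (hM : 0 < M)
    (hx : M / 2 ≤ |x|) :
    volume {y : ℝ | M / 2 ≤ |y| ∧ |x + y| ≤ M / 4 ∧ |c + resBO α x y| ≤ 2 * L}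
      ≤ ENNReal.ofReal (16 * L / M ^ (1 + α)) := by
  refine (Real.volume_le_diam _).trans ?_
  refine Metric.ediam_le ?_
  have main : ∀ y ∈ {y : ℝ | M / 2 ≤ |y| ∧ |x + y| ≤ M / 4 ∧ |c + resBO α x y| ≤ 2 * L},
      ∀ y' ∈ {y : ℝ | M / 2 ≤ |y| ∧ |x + y| ≤ M / 4 ∧ |c + resBO α x y| ≤ 2 * L},
      y ≤ y' → y' - y ≤ 16 * L / M ^ (1 + α) := by
    rintro y ⟨h1, h2, h3⟩ y' ⟨h1', h2', h3'⟩ hle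
    have hm := monoBO α x M y y' hα0 hM hle (by
      intro z hz
      rw [abs_le] at h2 h2'
      rcases le_abs.mp hx with hx | hx
      · rw [le_abs] at h1 h1' ⊢
        right
        rcases h1' with h | h
        · linarith
        · linarith [hz.2]
      · rw [le_abs] at h1 h1' ⊢
        left
        rcases h1 with h | h
        · linarith [hz.1]
        · linarith) h2 h2'
    rw [abs_le] at h3 h3'
    have hp : 0 < M ^ (1 + α) := by positivity
    have hq : M ^ (1 + α) / 4 ≤ (M / 2) ^ (1 + α) := by
      rw [Real.div_rpow hM.le (by norm_num)]
      have : (2 : ℝ) ^ (1 + α) ≤ 2 ^ (2 : ℝ) :=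
        Real.rpow_le_rpow_of_exponent_le (by norm_num) (by linarith)
      norm_num at this
      gcongr
    rw [le_div_iff₀ hp]
    have : M ^ (1 + α) / 4 * (y' - y) ≤ (M / 2) ^ (1 + α) * (y' - y) :=
      mul_le_mul_of_nonneg_right hq (by linarith)
    nlinarith
  intro y hy y' hy'
  rw [edist_dist]
  apply ENNReal.ofReal_le_ofReal
  rw [Real.dist_eq]
  rcases le_total y y' with h | h
  · rw [abs_sub_comm, abs_of_nonneg (by linarith)]
    exact main y hy y' hy' h
  · rw [abs_of_nonneg (by linarith)]
    exact main y' hy' y hy h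

lemma measurable_resBO (α : ℝ) : Measurable (fun q : ℝ × ℝ => resBO α q.1 q.2) := by
  unfold resBO omegaBO
  fun_prop

lemma resBO_symm (α x y : ℝ) : resBO α x y = resBO α y x := by
  unfold resBO
  rw [add_comm x y]; ring

/-- The set of admissible second variables. -/
def EBO (α M K L : ℝ) : Set ((ℝ × ℝ) × ℝ × ℝ) :=
  {w | M / 2 ≤ |w.1.1| ∧ M / 2 ≤ |w.2.1| ∧ |w.1.1 + w.2.1| ≤ M / 4 ∧ |w.2.2| ≤ 2 * K ∧
    |w.1.2 + w.2.2 + resBO α w.1.1 w.2.1| ≤ 2 * L}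

lemma measurableSet_EBO (α M K L : ℝ) : MeasurableSet (EBO α M K L) := by
  have h : Measurable (fun w : (ℝ × ℝ) × ℝ × ℝ => resBO α w.1.1 w.2.1) :=
    (measurable_resBO α).comp (by fun_prop : Measurable fun w : (ℝ × ℝ) × ℝ × ℝ => (w.1.1, w.2.1))
  have a1 : Measurable fun w : (ℝ × ℝ) × ℝ × ℝ => |w.1.1| := by fun_prop
  have a2 : Measurable fun w : (ℝ × ℝ) × ℝ × ℝ => |w.2.1| := by fun_prop
  have a3 : Measurable fun w : (ℝ × ℝ) × ℝ × ℝ => |w.1.1 + w.2.1| := by fun_prop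
  have a4 : Measurable fun w : (ℝ × ℝ) × ℝ × ℝ => |w.2.2| := by fun_prop
  have a5 : Measurable fun w : (ℝ × ℝ) × ℝ × ℝ => |w.1.2 + w.2.2 + resBO α w.1.1 w.2.1| := by
    fun_prop
  exact (measurableSet_le measurable_const a1).inter
    ((measurableSet_le measurable_const a2).inter
    ((measurableSet_le a3 measurable_const).inter
    ((measurableSet_le a4 measurable_const).inter
    (measurableSet_le a5 measurable_const))))

lemma sectionBO (α M K L : ℝ) (hα0 : 0 < α) (hα1 : α ≤ 1) (hM : 0 < M) (hK : 0 < K)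
    (w : ℝ × ℝ) :
    volume (Prod.mk w ⁻¹' EBO α M K L) ≤ ENNReal.ofReal (64 * K * L / M ^ (1 + α)) := by
  have hms : MeasurableSet (Prod.mk w ⁻¹' EBO α M K L) :=
    measurable_prodMk_left (measurableSet_EBO α M K L)
  by_cases hx : M / 2 ≤ |w.1|
  · rw [Measure.volume_eq_prod, Measure.prod_apply_symm hms]
    calc _ ≤ ∫⁻ s : ℝ, (Set.Icc (-(2 * K)) (2 * K)).indicator
            (fun _ => ENNReal.ofReal (16 * L / M ^ (1 + α))) s := by
          apply lintegral_mono
          intro s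
          by_cases hs : s ∈ Set.Icc (-(2 * K)) (2 * K)
          · rw [Set.indicator_of_mem hs]
            refine le_trans (measure_mono ?_) (sliceBO α w.1 M L (w.2 + s) hα0 hα1 hM hx)
            rintro y ⟨_, h2, h3, _, h5⟩
            exact ⟨h2, h3, h5⟩
          · rw [Set.indicator_of_notMem hs]
            refine le_of_eq ?_
            convert measure_empty (μ := (volume : Measure ℝ))
            rw [Set.eq_empty_iff_forall_notMem]
            rintro y ⟨_, h2, h3, h4, h5⟩
            exact hs (abs_le.mp h4)
      _ = _ := by
          rw [lintegral_indicator measurableSet_Icc, setLIntegral_const, Real.volume_Icc,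
            mul_comm, ← ENNReal.ofReal_mul (by linarith)]
          congr 1; ring
  · suffices hem : Prod.mk w ⁻¹' EBO α M K L = ∅ by
      rw [hem, measure_empty]; exact bot_le
    rw [Set.eq_empty_iff_forall_notMem]
    rintro y ⟨h1, _⟩
    exact hx h1

lemma shiftBO (α : ℝ) (G : ℝ × ℝ → ℝ≥0∞) (hG : Measurable G) (v : ℝ × ℝ) :
    ∫⁻ w : ℝ × ℝ, G (w.1 + v.1, w.2 + v.2 + resBO α w.1 v.1) = ∫⁻ z, G z := by
  have h : Measurable (fun w : ℝ × ℝ => resBO α w.1 v.1) :=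
    (measurable_resBO α).comp (by fun_prop : Measurable fun w : ℝ × ℝ => (w.1, v.1))
  rw [Measure.volume_eq_prod, lintegral_prod _ (by fun_prop), lintegral_prod _ (by fun_prop)]
  calc _ = ∫⁻ x : ℝ, ∫⁻ s : ℝ, G (x + v.1, s) := by
        apply lintegral_congr
        intro x
        simp only [add_assoc]
        exact lintegral_add_right_eq_self (fun s => G (x + v.1, s)) (v.2 + resBO α x v.1)
    _ = _ := lintegral_add_right_eq_self (fun x => ∫⁻ s : ℝ, G (x, s)) v.1

lemma normBO (M K r r' : ℝ) (hr : 0 < r) (hrr : r ≤ r') (hM : 0 < M) (hK : 0 < K)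
    (F : ℝ × ℝ → ℝ≥0∞) (hF : Measurable F)
    (hs : ∀ z, F z ≠ 0 → |z.1| ≤ 4 * M ∧ |z.2| ≤ 2 * K) :
    (∫⁻ z, F z ^ r) ^ (1 / r) ≤ (∫⁻ z, F z ^ r') ^ (1 / r') *
      ENNReal.ofReal (32 * M * K) ^ (1 / r - 1 / r') := by
  set B : Set (ℝ × ℝ) := Set.Icc (-(4 * M)) (4 * M) ×ˢ Set.Icc (-(2 * K)) (2 * K) with hB
  have hBm : MeasurableSet B := measurableSet_Icc.prod measurableSet_Icc
  have h := eLpNorm'_le_eLpNorm'_mul_rpow_measure_univ (μ := volume.restrict B) (f := F) hr hrr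
    hF.aestronglyMeasurable
  have hV : (volume.restrict B) Set.univ = ENNReal.ofReal (32 * M * K) := by
    rw [Measure.restrict_apply_univ, hB, Measure.volume_eq_prod, Measure.prod_prod,
      Real.volume_Icc, Real.volume_Icc, ← ENNReal.ofReal_mul (by linarith)]
    congr 1; ring
  have hI : ∀ q : ℝ, 0 < q → ∫⁻ z in B, F z ^ q = ∫⁻ z, F z ^ q := by
    intro q hq
    apply setLIntegral_eq_of_support_subset
    intro z hz
    have : F z ≠ 0 := by
      intro h0
      simp [h0, hq] at hz
    have := hs z this
    exact ⟨abs_le.mp this.1, abs_le.mp this.2⟩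
  simp only [eLpNorm', enorm_eq_self] at h
  rwa [hV, hI r hr, hI r' (by linarith)] at h

lemma keyBO (α M K L r r' : ℝ) (hα0 : 0 < α) (hα1 : α ≤ 1) (hM : 0 < M) (hK : 0 < K)
    (hr1 : 1 < r) (hr2 : r ≤ r') (hc : r.HolderConjugate r')
    (F₁ F₂ F : ℝ × ℝ → ℝ≥0∞) (h₁ : Measurable F₁) (h₂ : Measurable F₂) (h : Measurable F)
    (s₁ : ∀ z, F₁ z ≠ 0 → M / 2 ≤ |z.1|)
    (s₂ : ∀ z, F₂ z ≠ 0 → M / 2 ≤ |z.1| ∧ |z.1| ≤ 4 * M ∧ |z.2| ≤ 2 * K)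
    (s : ∀ z, F z ≠ 0 → |z.1| ≤ M / 4 ∧ |z.2| ≤ 2 * L) :
    ∫⁻ w : ℝ × ℝ, ∫⁻ v : ℝ × ℝ, F₁ w * F₂ v * F (w.1 + v.1, w.2 + v.2 + resBO α w.1 v.1) ≤
      ENNReal.ofReal (64 * K * L / M ^ (1 + α)) ^ (1 / r') *
        ENNReal.ofReal (32 * M * K) ^ (1 / r - 1 / r') *
        ((∫⁻ z, F₁ z ^ r') ^ (1 / r') * (∫⁻ z, F₂ z ^ r') ^ (1 / r') *
          (∫⁻ z, F z ^ r) ^ (1 / r)) := by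
  have hr0 : 0 < r := by linarith
  have hr0' : 0 < r' := by linarith
  have hres : Measurable (fun w : (ℝ × ℝ) × ℝ × ℝ => resBO α w.1.1 w.2.1) :=
    (measurable_resBO α).comp (by fun_prop : Measurable fun w : (ℝ × ℝ) × ℝ × ℝ => (w.1.1, w.2.1))
  set H : (ℝ × ℝ) × ℝ × ℝ → ℝ≥0∞ := fun q =>
    F₂ q.2 * F (q.1.1 + q.2.1, q.1.2 + q.2.2 + resBO α q.1.1 q.2.1) with hH
  have hHm : Measurable H := by fun_prop
  set χ : (ℝ × ℝ) × ℝ × ℝ → ℝ≥0∞ := (EBO α M K L).indicator (fun _ => 1) with hχ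
  have hχm : Measurable χ := measurable_const.indicator (measurableSet_EBO α M K L)
  set g : ℝ × ℝ → ℝ≥0∞ := fun w => ∫⁻ v : ℝ × ℝ, H (w, v) * χ (w, v) with hg
  have hgm : Measurable g := (hHm.mul hχm).lintegral_prod_right'
  set B := ENNReal.ofReal (64 * K * L / M ^ (1 + α)) with hB
  have step1 : ∫⁻ w : ℝ × ℝ, ∫⁻ v : ℝ × ℝ,
      F₁ w * F₂ v * F (w.1 + v.1, w.2 + v.2 + resBO α w.1 v.1) ≤ ∫⁻ w, (F₁ * g) w := by
    apply lintegral_mono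
    intro w
    simp only [Pi.mul_apply, hg]
    rw [← lintegral_const_mul _ (by fun_prop)]
    apply lintegral_mono
    intro v
    simp only [hH, hχ]
    by_cases hE : (w, v) ∈ EBO α M K L
    · rw [Set.indicator_of_mem hE, mul_one, mul_assoc]
    · rw [Set.indicator_of_notMem hE, mul_zero, mul_zero]
      by_contra hne
      apply hE
      have hne : F₁ w * F₂ v * F (w.1 + v.1, w.2 + v.2 + resBO α w.1 v.1) ≠ 0 := by
        intro h0; exact hne h0.le
      have n3 := right_ne_zero_of_mul hne
      have n1 := left_ne_zero_of_mul (left_ne_zero_of_mul hne)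
      have n2 := right_ne_zero_of_mul (left_ne_zero_of_mul hne)
      exact ⟨s₁ _ n1, (s₂ _ n2).1, (s _ n3).1, (s₂ _ n2).2.2, (s _ n3).2⟩
  have step2 := ENNReal.lintegral_mul_le_Lp_mul_Lq volume hc.symm h₁.aemeasurable hgm.aemeasurable
  have hgle : ∀ w, g w ^ r ≤ (∫⁻ v, H (w, v) ^ r) * B ^ (r / r') := by
    intro w
    have e := ENNReal.lintegral_mul_le_Lp_mul_Lq volume hc
      (f := fun v => H (w, v)) (g := fun v => χ (w, v))
      (by fun_prop) (by fun_prop)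
    have e2 : ∫⁻ v, χ (w, v) ^ r' ≤ B := by
      refine le_trans (le_of_eq ?_) (sectionBO α M K L hα0 hα1 hM hK w)
      rw [← lintegral_indicator_one (measurable_prodMk_left (measurableSet_EBO α M K L))]
      apply lintegral_congr
      intro v
      by_cases hE : (w, v) ∈ EBO α M K L
      · rw [hχ, Set.indicator_of_mem hE, Set.indicator_of_mem (by exact hE)]; simp
      · rw [hχ, Set.indicator_of_notMem hE, Set.indicator_of_notMem (by exact hE)]; simp [hr0']
    have e3 : g w ≤ (∫⁻ v, H (w, v) ^ r) ^ (1 / r) * B ^ (1 / r') :=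
      e.trans (by gcongr)
    calc g w ^ r ≤ ((∫⁻ v, H (w, v) ^ r) ^ (1 / r) * B ^ (1 / r')) ^ r := by gcongr
      _ = _ := by
        rw [ENNReal.mul_rpow_of_nonneg _ _ hr0.le, ← ENNReal.rpow_mul, ← ENNReal.rpow_mul]
        congr 2
        · rw [one_div_mul_cancel hr0.ne', ENNReal.rpow_one]
        · ring
  have step3 : ∫⁻ w, g w ^ r ≤ (∫⁻ z, F₂ z ^ r) * (∫⁻ z, F z ^ r) * B ^ (r / r') := by
    calc ∫⁻ w, g w ^ r ≤ ∫⁻ w, (∫⁻ v, H (w, v) ^ r) * B ^ (r / r') := lintegral_mono hgle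
      _ = (∫⁻ w, ∫⁻ v, H (w, v) ^ r) * B ^ (r / r') := by
        rw [lintegral_mul_const]
        exact (hHm.pow_const r).lintegral_prod_right'
      _ = (∫⁻ v, ∫⁻ w, H (w, v) ^ r) * B ^ (r / r') := by
        rw [lintegral_lintegral_swap]
        exact (hHm.pow_const r).aemeasurable
      _ = _ := by
        congr 1
        rw [← lintegral_mul_const _ (h₂.pow_const r)]
        apply lintegral_congr
        intro v
        have := shiftBO α (fun z => F z ^ r) (h.pow_const r) v
        rw [← this, ← lintegral_const_mul]
        · apply lintegral_congr
          intro w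
          simp only [hH]
          rw [ENNReal.mul_rpow_of_nonneg _ _ hr0.le]
        · have : Measurable (fun w : ℝ × ℝ => resBO α w.1 v.1) :=
            (measurable_resBO α).comp (by fun_prop : Measurable fun w : ℝ × ℝ => (w.1, v.1))
          fun_prop
  have step4 := normBO M K r r' hr0 hr2 hM hK F₂ h₂ (fun z hz => (s₂ z hz).2)
  refine step1.trans (step2.trans ?_)
  calc _ ≤ (∫⁻ z, F₁ z ^ r') ^ (1 / r') *
        ((∫⁻ z, F₂ z ^ r) * (∫⁻ z, F z ^ r) * B ^ (r / r')) ^ (1 / r) := by gcongr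
    _ = (∫⁻ z, F₁ z ^ r') ^ (1 / r') *
        ((∫⁻ z, F₂ z ^ r) ^ (1 / r) * (∫⁻ z, F z ^ r) ^ (1 / r) * B ^ (1 / r')) := by
      have hi : 0 ≤ 1 / r := by positivity
      rw [ENNReal.mul_rpow_of_nonneg _ _ hi, ENNReal.mul_rpow_of_nonneg _ _ hi,
        ← ENNReal.rpow_mul]
      congr 3
      field_simp
    _ ≤ (∫⁻ z, F₁ z ^ r') ^ (1 / r') *
        (((∫⁻ z, F₂ z ^ r') ^ (1 / r') * ENNReal.ofReal (32 * M * K) ^ (1 / r - 1 / r')) *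
          (∫⁻ z, F z ^ r) ^ (1 / r) * B ^ (1 / r')) := by gcongr
    _ = _ := by ring

lemma constBO (α M K L r r' : ℝ) (hM : 0 < M) (hK : 0 < K) (hL : 0 < L)
    (hr : 0 < r) (hr0' : 0 < r') (hrr : r ≤ r') :
    ENNReal.ofReal (64 * K * L / M ^ (1 + α)) ^ (1 / r') *
        ENNReal.ofReal (32 * M * K) ^ (1 / r - 1 / r') =
    ENNReal.ofReal ((64 : ℝ) ^ (1 / r') * (32 : ℝ) ^ (1 / r - 1 / r') *
      (K ^ (1 / r) * L ^ (1 / r') * M ^ (1 / r - 1 / r') * M ^ (-((1 + α) / r')))) := by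
  have hd : 0 ≤ 1 / r - 1 / r' := sub_nonneg.mpr (one_div_le_one_div_of_le hr hrr)
  rw [ENNReal.ofReal_rpow_of_nonneg (by positivity) (by positivity),
    ENNReal.ofReal_rpow_of_nonneg (by positivity) hd, ← ENNReal.ofReal_mul (by positivity)]
  congr 1
  have e1 : K ^ (1 / r) = K ^ (1 / r') * K ^ (1 / r - 1 / r') := by
    rw [← Real.rpow_add hK]; congr 1; ring
  have e2 : (M ^ (1 + α)) ^ (1 / r') = M ^ ((1 + α) / r') := by
    rw [← Real.rpow_mul hM.le]; congr 1; ring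
  rw [Real.div_rpow (by positivity) (by positivity), Real.mul_rpow (by positivity) hL.le,
    Real.mul_rpow (by norm_num) hK.le, Real.mul_rpow (by positivity) hK.le,
    Real.mul_rpow (by norm_num) hM.le, e1, e2, Real.rpow_neg hM.le]
  ring


/-- High×high → low interactions, dominant modulation on an input (Lemma 3.3 (b)). -/
theorem stmt11 (α r r' : ℝ) (hα0 : 0 < α) (hα1 : α ≤ 1)
    (hr1 : 1 < r) (hr2 : r ≤ 2) (hconj : 1 / r + 1 / r' = 1) :
    ∃ C > (0 : ℝ), ∀ N₁ N₂ N L₁ L₂ L : ℝ,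
      1 ≤ N₁ → 1 ≤ N₂ → 1 ≤ N → 1 ≤ L₁ → 1 ≤ L₂ → 1 ≤ L →
      N₁ / 2 ≤ N₂ → N₂ ≤ 2 * N₁ → N ≤ N₁ / 8 →
      ∀ Li : ℝ, (Li = L₁ ∨ Li = L₂) → Li = max L (max L₁ L₂) →
      ∀ f₁ f₂ f : ℝ × ℝ → ℝ,
        Measurable f₁ → (∀ z, 0 ≤ f₁ z) → Function.support f₁ ⊆ Dset N₁ L₁ →
        Measurable f₂ → (∀ z, 0 ≤ f₂ z) → Function.support f₂ ⊆ Dset N₂ L₂ →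
        Measurable f → (∀ z, 0 ≤ f z) → Function.support f ⊆ Dset N L →
        Jfun α f₁ f₂ f ≤
          ENNReal.ofReal (C * (L₁ ^ (1 / r) * L₂ ^ (1 / r) * L ^ (1 / r') * Li ^ (-(1 / r)) *
              N₁ ^ (1 / r - 1 / r') * N₁ ^ (-((1 + α) / r')))) *
            (LpN r' f₁ * LpN r' f₂ * LpN r f) := by
  have hr0 : 0 < r := by linarith
  have hc : r.HolderConjugate r' := by
    rw [Real.holderConjugate_iff]
    exact ⟨hr1, by simpa [one_div] using hconj⟩
  have hr0' : 0 < r' := hc.symm.pos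
  have hrr : r ≤ r' := by
    have h1 : 1 / 2 ≤ 1 / r := one_div_le_one_div_of_le hr0 hr2
    have h2 : 1 / r' ≤ 1 / r := by linarith
    exact (one_div_le_one_div hr0' hr0).mp h2
  refine ⟨(64 : ℝ) ^ (1 / r') * (32 : ℝ) ^ (1 / r - 1 / r'), by positivity, ?_⟩
  intro N₁ N₂ N L₁ L₂ L hN₁ hN₂ hN hL₁ hL₂ hL hN12 hN21 hNN Li hLi _ f₁ f₂ f m₁ p₁ s₁ m₂ p₂ s₂
    m p s
  have hres : Measurable (fun w : (ℝ × ℝ) × ℝ × ℝ => resBO α w.1.1 w.2.1) :=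
    (measurable_resBO α).comp (by fun_prop : Measurable fun w : (ℝ × ℝ) × ℝ × ℝ => (w.1.1, w.2.1))
  have supp : ∀ {g : ℝ × ℝ → ℝ} {A : Set (ℝ × ℝ)}, Function.support g ⊆ A → ∀ z,
      ENNReal.ofReal (g z) ≠ 0 → z ∈ A := by
    intro g A hg z hz
    apply hg
    intro h0
    rw [h0] at hz
    simp at hz
  have hsF : ∀ z, ENNReal.ofReal (f z) ≠ 0 → |z.1| ≤ N₁ / 4 ∧ |z.2| ≤ 2 * L := by
    intro z hz
    obtain ⟨_, a, _, b⟩ := supp s z hz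
    exact ⟨by linarith, b⟩
  have hmJ : Measurable fun w : (ℝ × ℝ) × ℝ × ℝ =>
    ENNReal.ofReal (f₁ (w.1.1, w.1.2) * f₂ (w.2.1, w.2.2) *
      f (w.1.1 + w.2.1, w.1.2 + w.2.2 + resBO α w.1.1 w.2.1)) := by fun_prop
  unfold Jfun LpN
  rcases hLi with hLi | hLi
  · have key := keyBO α N₁ L₂ L r r' hα0 hα1 (by linarith) (by linarith) hr1 hrr hc
      (fun z => ENNReal.ofReal (f₁ z)) (fun z => ENNReal.ofReal (f₂ z))
      (fun z => ENNReal.ofReal (f z)) (by fun_prop) (by fun_prop) (by fun_prop)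
      (fun z hz => by
        obtain ⟨a, _, _, _⟩ := supp s₁ z hz
        linarith)
      (fun z hz => by
        obtain ⟨a, b, _, d⟩ := supp s₂ z hz
        exact ⟨by linarith, by linarith, d⟩) hsF
    rw [constBO α N₁ L₂ L r r' (by linarith) (by linarith) (by linarith) hr0 hr0' hrr] at key
    have e : L₁ ^ (1 / r) * Li ^ (-(1 / r)) = 1 := by
      rw [hLi, ← Real.rpow_add (by linarith)]; simp
    rw [Measure.volume_eq_prod, lintegral_prod _ hmJ.aemeasurable]
    refine le_trans (le_of_eq ?_) (key.trans (le_of_eq ?_))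
    · apply lintegral_congr; intro w
      apply lintegral_congr; intro v
      rw [ENNReal.ofReal_mul (mul_nonneg (p₁ _) (p₂ _)), ENNReal.ofReal_mul (p₁ _)]
    · congr 2
      congr 1
      linear_combination (-(L₂ ^ (1 / r) * L ^ (1 / r') * N₁ ^ (1 / r - 1 / r') *
        N₁ ^ (-((1 + α) / r')))) * e
  · have key := keyBO α N₁ L₁ L r r' hα0 hα1 (by linarith) (by linarith) hr1 hrr hc
      (fun z => ENNReal.ofReal (f₂ z)) (fun z => ENNReal.ofReal (f₁ z))
      (fun z => ENNReal.ofReal (f z)) (by fun_prop) (by fun_prop) (by fun_prop)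
      (fun z hz => by
        obtain ⟨a, _, _, _⟩ := supp s₂ z hz
        linarith)
      (fun z hz => by
        obtain ⟨a, b, _, d⟩ := supp s₁ z hz
        exact ⟨by linarith, by linarith, d⟩) hsF
    rw [constBO α N₁ L₁ L r r' (by linarith) (by linarith) (by linarith) hr0 hr0' hrr] at key
    have e : L₂ ^ (1 / r) * Li ^ (-(1 / r)) = 1 := by
      rw [hLi, ← Real.rpow_add (by linarith)]; simp
    rw [Measure.volume_eq_prod, lintegral_prod_symm _ hmJ.aemeasurable]
    refine le_trans (le_of_eq ?_) (key.trans (le_of_eq ?_))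
    · apply lintegral_congr; intro w
      apply lintegral_congr; intro v
      rw [ENNReal.ofReal_mul (mul_nonneg (p₁ _) (p₂ _)), ENNReal.ofReal_mul (p₁ _),
        mul_comm (ENNReal.ofReal (f₁ _)), resBO_symm α v.1 w.1, add_comm v.1 w.1,
        add_comm v.2 w.2]
    · rw [mul_comm ((∫⁻ z, ENNReal.ofReal (f₂ z) ^ r') ^ (1 / r'))]
      congr 2
      congr 1
      linear_combination (-(L₁ ^ (1 / r) * L ^ (1 / r') * N₁ ^ (1 / r - 1 / r') *
        N₁ ^ (-((1 + α) / r')))) * e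
end

section
/- (Resonance lower bound, equal signs.) Let 0 < α ≤ 1. There exists c > 0 (depending only on α) such that for all ξ₁, ξ₂ > 0, |Ω(ξ₁,ξ₂)| = (ξ₁+ξ₂)^{2+α} − ξ₁^{2+α} − ξ₂^{2+α} ≥ c (ξ₁+ξ₂)^{1+α} min{ξ₁, ξ₂}. In particular, if in addition ξ₁ and ξ₂ are comparable, |Ω(ξ₁,ξ₂)| ≳ max{ξ₁,ξ₂}^{2+α}. -/
lemma resBO_core (α a b : ℝ) (hα0 : 0 < α) (ha : 0 < a) (hb : 0 < b) (hab : a ≤ b) :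
    1 / 2 * ((a + b) ^ (1 + α) * a) ≤
      (a + b) ^ (2 + α) - a ^ (2 + α) - b ^ (2 + α) := by
  have e2 : ∀ x : ℝ, 0 < x → x ^ (2 + α) = x * x ^ (1 + α) := by
    intro x hx
    rw [show (2 + α) = 1 + (1 + α) by ring, Real.rpow_add hx 1 (1 + α), Real.rpow_one]
  have e1 : ∀ x : ℝ, 0 < x → x ^ (1 + α) = x * x ^ α := by
    intro x hx
    rw [Real.rpow_add hx, Real.rpow_one]
  have hs : 0 < a + b := by positivity
  have h1 : b ^ (1 + α) ≤ (a + b) ^ (1 + α) :=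
    Real.rpow_le_rpow hb.le (by linarith) (by linarith)
  have h2 : a ^ α ≤ (a + b) ^ α := Real.rpow_le_rpow ha.le (by linarith) hα0.le
  have h3 : a ^ (1 + α) ≤ 1 / 2 * (a + b) ^ (1 + α) := by
    rw [e1 a ha, e1 _ hs, ← mul_assoc]
    exact mul_le_mul (by linarith) h2 (by positivity) (by positivity)
  rw [e2 a ha, e2 b hb, e2 _ hs]
  have h4 := mul_le_mul_of_nonneg_left h1 hb.le
  have h5 := mul_le_mul_of_nonneg_left h3 ha.le
  nlinarith

/-- Resonance lower bound in the equal-sign case. -/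
theorem stmt14 (α : ℝ) (hα0 : 0 < α) (hα1 : α ≤ 1) :
    ∃ c > (0 : ℝ), ∀ ξ₁ ξ₂ : ℝ, 0 < ξ₁ → 0 < ξ₂ →
      |resBO α ξ₁ ξ₂| = (ξ₁ + ξ₂) ^ (2 + α) - ξ₁ ^ (2 + α) - ξ₂ ^ (2 + α) ∧
      c * ((ξ₁ + ξ₂) ^ (1 + α) * min ξ₁ ξ₂) ≤ |resBO α ξ₁ ξ₂| ∧
      (ξ₁ ≤ 2 * ξ₂ → ξ₂ ≤ 2 * ξ₁ →
        c * max ξ₁ ξ₂ ^ (2 + α) ≤ |resBO α ξ₁ ξ₂|) := by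
  have e2 : ∀ x : ℝ, 0 < x → x ^ (2 + α) = x * x ^ (1 + α) := by
    intro x hx
    rw [show (2 + α) = 1 + (1 + α) by ring, Real.rpow_add hx 1 (1 + α), Real.rpow_one]
  refine ⟨1 / 4, by norm_num, ?_⟩
  intro a b ha hb
  have hs : 0 < a + b := by positivity
  have key : 1 / 2 * ((a + b) ^ (1 + α) * min a b) ≤
      (a + b) ^ (2 + α) - a ^ (2 + α) - b ^ (2 + α) := by
    rcases le_total a b with h | h
    · rw [min_eq_left h]
      exact resBO_core α a b hα0 ha hb h
    · rw [min_eq_right h]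
      have := resBO_core α b a hα0 hb ha h
      rw [add_comm b a] at this
      linarith
  have hm : 0 < min a b := lt_min ha hb
  have hpos : 0 < (a + b) ^ (1 + α) * min a b := by positivity
  have hres : |resBO α a b| = (a + b) ^ (2 + α) - a ^ (2 + α) - b ^ (2 + α) := by
    have : resBO α a b = (a + b) ^ (2 + α) - a ^ (2 + α) - b ^ (2 + α) := by
      unfold resBO omegaBO
      rw [abs_of_pos ha, abs_of_pos hb, abs_of_pos hs, e2 a ha, e2 b hb, e2 _ hs]
      ring
    rw [this, abs_of_nonneg (by linarith)]
  refine ⟨hres, by rw [hres]; linarith, ?_⟩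
  intro hab hba
  rw [hres]
  refine le_trans ?_ key
  have hM : 0 < max a b := lt_max_of_lt_left ha
  have h1 : max a b ≤ 2 * min a b := by
    rcases le_total a b with h | h
    · rw [min_eq_left h, max_eq_right h]; exact hba
    · rw [min_eq_right h, max_eq_left h]; exact hab
  have h2 : (max a b) ^ (1 + α) ≤ (a + b) ^ (1 + α) :=
    Real.rpow_le_rpow hM.le (max_le (by linarith) (by linarith)) (by linarith)
  rw [e2 _ hM]
  have h3 := mul_le_mul h1 h2 (by positivity) (by positivity)
  linarith
end

section
/- (Resonance lower bound, high×low.) Let 0 < α ≤ 1. There exists c > 0 (depending only on α) such that for all ξ₁, ξ₂ ∈ ℝ with |ξ₁| ≥ 4|ξ₂| > 0, one has |Ω(ξ₁,ξ₂)| ≥ c |ξ₁|^{1+α} |ξ₂|. -/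
/-- Resonance lower bound in the high×low case. -/
theorem stmt15 (α : ℝ) (hα0 : 0 < α) (hα1 : α ≤ 1) :
    ∃ c > (0 : ℝ), ∀ ξ₁ ξ₂ : ℝ, 4 * |ξ₂| ≤ |ξ₁| → 0 < |ξ₂| →
      c * (|ξ₁| ^ (1 + α) * |ξ₂|) ≤ |resBO α ξ₁ ξ₂| := by
  refine ⟨3 / 4, by norm_num, ?_⟩
  intro x y h hy
  have hq : 0 ≤ 1 + α := by linarith
  have h1 : |y| ^ (1 + α) ≤ |x| ^ (1 + α) / 4 := by
    have e1 : |y| ^ (1 + α) ≤ (|x| / 4) ^ (1 + α) :=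
      Real.rpow_le_rpow (abs_nonneg _) (by linarith) hq
    rw [Real.div_rpow (abs_nonneg _) (by norm_num)] at e1
    have e2 : (4 : ℝ) ≤ 4 ^ (1 + α) := by
      have := Real.rpow_le_rpow_of_exponent_le (x := 4) (by norm_num) (show (1 : ℝ) ≤ 1 + α by linarith)
      rwa [Real.rpow_one] at this
    refine e1.trans ?_
    gcongr
  have h2 : |x| ≤ |x + y| → |x| ^ (1 + α) ≤ |x + y| ^ (1 + α) :=
    fun h => Real.rpow_le_rpow (abs_nonneg _) h hq
  have h3 : |x + y| ≤ |x| → |x + y| ^ (1 + α) ≤ |x| ^ (1 + α) :=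
    fun h => Real.rpow_le_rpow (abs_nonneg _) h hq
  unfold resBO omegaBO
  generalize |x| ^ (1 + α) = A at *
  generalize |y| ^ (1 + α) = B at *
  generalize |x + y| ^ (1 + α) = C at *
  rcases le_total 0 x with hx | hx <;> rcases le_total 0 y with hy0 | hy0
  · rw [abs_of_nonneg hx, abs_of_nonneg hy0] at *
    rw [abs_of_nonneg (by linarith : 0 ≤ x + y)] at *
    have := h2 (by linarith)
    refine le_trans ?_ (le_abs_self _)
    nlinarith [mul_le_mul_of_nonneg_left this (by linarith : 0 ≤ x + y), mul_le_mul_of_nonneg_left h1 hy0]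
  · rw [abs_of_nonneg hx, abs_of_nonpos hy0] at *
    rw [abs_of_nonneg (by linarith : 0 ≤ x + y)] at *
    have := h3 (by linarith)
    refine le_trans ?_ (neg_le_abs _)
    nlinarith [mul_le_mul_of_nonneg_left this (by linarith : 0 ≤ x + y), mul_le_mul_of_nonneg_left h1 (by linarith : 0 ≤ -y)]
  · rw [abs_of_nonpos hx, abs_of_nonneg hy0] at *
    rw [abs_of_nonpos (by linarith : x + y ≤ 0)] at *
    have := h3 (by linarith)
    refine le_trans ?_ (le_abs_self _)
    nlinarith [mul_le_mul_of_nonneg_left this (by linarith : 0 ≤ -(x + y)), mul_le_mul_of_nonneg_left h1 hy0]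
  · rw [abs_of_nonpos hx, abs_of_nonpos hy0] at *
    rw [abs_of_nonpos (by linarith : x + y ≤ 0)] at *
    have := h2 (by linarith)
    refine le_trans ?_ (neg_le_abs _)
    nlinarith [mul_le_mul_of_nonneg_left this (by linarith : 0 ≤ -(x + y)), mul_le_mul_of_nonneg_left h1 (by linarith : 0 ≤ -y)]
end
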